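/- Let k = k(n) be a sequence of integers with ⌈log₂ n − 2·log₂log₂ n⌉ + 1 ≤ k(n) ≤ n−1. Then w.h.p. Q^n(k(n)) is k(n)-connected. -/

import Mathlib

open scoped Classical
open Filter

noncomputable section

/-- The vertex set of the `n`-dimensional hypercube: `{0,1}^n`. -/
abbrev Vtx (n : ℕ) := Fin n → Bool

/-- The `n`-dimensional hypercube graph `Q^n`: two vertices are adjacent iff they
differ in exactly one coordinate. -/
def cubeGraph (n : ℕ) : SimpleGraph (Vtx n) :=
  SimpleGraph.fromRel (fun u v => hammingDist u v = 1)

/-- Sample space for the `k`-out model on `Q^n`: each vertex `v` chooses a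
`k`-element set of its neighbours (equivalently, `k` incident edges). -/
abbrev KOut (n k : ℕ) :=
  ∀ v : Vtx n, {s : Finset (Vtx n) // s.card = k ∧ ∀ u ∈ s, (cubeGraph n).Adj v u}

/-- The random subgraph `Q^n(k)` produced by an outcome of the `k`-out model:
`u` and `v` are adjacent iff one of them chose the edge between them. -/
def kOutGraph (n k : ℕ) (ω : KOut n k) : SimpleGraph (Vtx n) :=
  SimpleGraph.fromRel (fun u v => v ∈ (ω u).1)

/-- Uniform (counting) probability of an event on a finite sample space. -/
def prob {Ω : Type*} [Finite Ω] (p : Ω → Prop) : ℝ :=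
  (Nat.card {ω : Ω // p ω} : ℝ) / (Nat.card Ω : ℝ)

/-- Number of vertices in the connected component of `v` in `G`. -/
def compSize {V : Type*} (G : SimpleGraph V) (v : V) : ℕ :=
  Nat.card {w : V // G.Reachable v w}

/-- A graph is `ℓ`-connected if it has more than `ℓ` vertices and remains connected
whenever fewer than `ℓ` vertices are removed. -/
def IsLConnected {V : Type*} [Fintype V] (G : SimpleGraph V) (l : ℕ) : Prop :=
  l < Fintype.card V ∧
    ∀ s : Finset V, s.card < l → (G.induce ((↑s : Set V)ᶜ)).Connected

/-! ### The hypercube: coordinate flips and neighbourhoods -/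

/-- The vertex obtained from `v` by flipping its `i`-th coordinate. -/
def flipAt {n : ℕ} (v : Vtx n) (i : Fin n) : Vtx n := Function.update v i (!v i)

lemma flipAt_self {n : ℕ} (v : Vtx n) (i : Fin n) : flipAt v i i = !v i := by
  simp [flipAt]

lemma flipAt_of_ne {n : ℕ} (v : Vtx n) {i j : Fin n} (h : j ≠ i) : flipAt v i j = v j := by
  simp [flipAt, h]

lemma flipAt_flipAt {n : ℕ} (v : Vtx n) (i : Fin n) : flipAt (flipAt v i) i = v := by
  ext j
  by_cases h : j = i
  · subst h; simp [flipAt]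
  · simp [flipAt, h]

lemma flipAt_left_injective {n : ℕ} (i : Fin n) :
    Function.Injective (fun v : Vtx n => flipAt v i) := fun u v h => by
  have := congrArg (fun w => flipAt w i) h
  simpa only [flipAt_flipAt] using this

lemma flipAt_injective {n : ℕ} (v : Vtx n) : Function.Injective (flipAt v) := fun i j h => by
  by_contra hij
  have := congrFun h i
  rw [flipAt_self, flipAt_of_ne v hij] at this
  cases hv : v i <;> simp_all

lemma flipAt_ne {n : ℕ} (v : Vtx n) (i : Fin n) : flipAt v i ≠ v := fun h => by
  have := congrFun h i
  rw [flipAt_self] at this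
  cases hv : v i <;> simp_all

lemma cubeGraph_adj_iff {n : ℕ} {u v : Vtx n} :
    (cubeGraph n).Adj u v ↔ ∃ i, v = flipAt u i := by
  have key : hammingDist u v = 1 ↔ ∃ i, v = flipAt u i := by
    unfold hammingDist
    rw [Finset.card_eq_one]
    constructor
    · rintro ⟨i, hi⟩
      refine ⟨i, funext fun j => ?_⟩
      have hj := congrArg (fun s => j ∈ s) hi
      simp only [Finset.mem_filter, Finset.mem_univ, true_and, Finset.mem_singleton,
        eq_iff_iff] at hj
      by_cases h : j = i
      · subst h
        rw [flipAt_self]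
        have := hj.2 rfl
        cases hu : u j <;> cases hv : v j <;> simp_all
      · rw [flipAt_of_ne u h]
        by_contra hne
        exact h (hj.1 (fun e => hne e.symm))
    · rintro ⟨i, rfl⟩
      refine ⟨i, ?_⟩
      ext j
      by_cases h : j = i
      · subst h; simp [flipAt_self]
      · simp [flipAt_of_ne u h, h]
  unfold cubeGraph
  rw [SimpleGraph.fromRel_adj, hammingDist_comm v u, or_self, key]
  constructor
  · exact fun h => h.2
  · rintro ⟨i, rfl⟩
    exact ⟨(flipAt_ne u i).symm, i, rfl⟩

/-- The set of neighbours of `v` in the hypercube. -/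
def nbrs {n : ℕ} (v : Vtx n) : Finset (Vtx n) := Finset.univ.image (flipAt v)

lemma mem_nbrs {n : ℕ} {u v : Vtx n} : u ∈ nbrs v ↔ ∃ i, u = flipAt v i := by
  simp [nbrs, eq_comm]

lemma flipAt_mem_nbrs {n : ℕ} (v : Vtx n) (i : Fin n) : flipAt v i ∈ nbrs v :=
  mem_nbrs.2 ⟨i, rfl⟩

lemma mem_nbrs_comm {n : ℕ} {u v : Vtx n} : u ∈ nbrs v ↔ v ∈ nbrs u := by
  have : ∀ a b : Vtx n, a ∈ nbrs b → b ∈ nbrs a := fun a b h => by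
    obtain ⟨i, rfl⟩ := mem_nbrs.1 h
    exact mem_nbrs.2 ⟨i, (flipAt_flipAt b i).symm⟩
  exact ⟨this _ _, this _ _⟩

lemma adj_iff_mem_nbrs {n : ℕ} {u v : Vtx n} : (cubeGraph n).Adj u v ↔ v ∈ nbrs u := by
  rw [cubeGraph_adj_iff, mem_nbrs]

lemma card_nbrs {n : ℕ} (v : Vtx n) : (nbrs v).card = n := by
  rw [nbrs, Finset.card_image_of_injective _ (flipAt_injective v), Finset.card_univ,
    Fintype.card_fin]

lemma not_mem_nbrs_self {n : ℕ} (v : Vtx n) : v ∉ nbrs v := fun h => by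
  obtain ⟨i, hi⟩ := mem_nbrs.1 h
  exact flipAt_ne v i hi.symm

/-- Two distinct vertices of the hypercube have at most two common neighbours. -/
lemma card_common_nbrs_le {n : ℕ} {u v : Vtx n} (huv : u ≠ v) :
    (nbrs u ∩ nbrs v).card ≤ 2 := by
  rcases (nbrs u ∩ nbrs v).eq_empty_or_nonempty with h | ⟨w, hw⟩
  · simp [h]
  · rw [Finset.mem_inter, mem_nbrs, mem_nbrs] at hw
    obtain ⟨⟨i, rfl⟩, j, hj⟩ := hw
    refine (Finset.card_le_card (t := {flipAt u i, flipAt u j}) ?_).trans Finset.card_le_two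
    intro x hx
    rw [Finset.mem_inter, mem_nbrs, mem_nbrs] at hx
    obtain ⟨⟨a, rfl⟩, b, hb⟩ := hx
    rw [Finset.mem_insert, Finset.mem_singleton]
    by_contra hne
    push Not at hne
    have hai : a ≠ i := fun h => hne.1 (by rw [h])
    have haj : a ≠ j := fun h => hne.2 (by rw [h])
    have hab : a ≠ b := fun h => by
      subst h
      exact huv (flipAt_left_injective a hb)
    have h1 := congrFun hj a
    rw [flipAt_of_ne u hai, flipAt_of_ne v haj] at h1
    have h2 := congrFun hb a
    rw [flipAt_self, flipAt_of_ne v hab, h1] at h2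
    cases hv : v a <;> simp_all

/-! ### The edge-isoperimetric inequality -/

/-- Twice the number of edges of the hypercube spanned by `X`. -/
def spanDeg {n : ℕ} (X : Finset (Vtx n)) : ℕ := ∑ v ∈ X, (nbrs v ∩ X).card

lemma two_mul_le_binEntropy {x : ℝ} (h0 : 0 ≤ x) (h1 : x ≤ 1 / 2) :
    2 * x * Real.log 2 ≤ Real.binEntropy x := by
  have hc := Real.strictConcave_binEntropy.concaveOn
  have m0 : (0 : ℝ) ∈ Set.Icc 0 1 := by norm_num
  have m1 : (2⁻¹ : ℝ) ∈ Set.Icc 0 1 := by constructor <;> norm_num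
  have := hc.2 m0 m1 (show 0 ≤ 1 - 2 * x by linarith) (show 0 ≤ 2 * x by linarith) (by ring)
  simp only [Real.binEntropy_zero, Real.binEntropy_two_inv, smul_eq_mul, mul_zero, zero_add] at this
  have e : 2 * x * 2⁻¹ = x := by ring
  rwa [e] at this

lemma mul_logb_add_mul_logb_le {a b : ℝ} (ha : 0 ≤ a) (hb : 0 ≤ b) :
    a * Real.logb 2 a + b * Real.logb 2 b + 2 * min a b ≤ (a + b) * Real.logb 2 (a + b) := by
  wlog hab : b ≤ a generalizing a b
  · have := this hb ha (le_of_not_ge hab)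
    rw [min_comm, add_comm a b]
    linarith
  rcases hb.eq_or_lt with rfl | hb
  · simp [ha]
  have ha' : 0 < a := lt_of_lt_of_le hb hab
  have hs : 0 < a + b := by linarith
  rw [min_eq_right hab]
  have hl : 0 < Real.log 2 := Real.log_pos (by norm_num)
  have h := two_mul_le_binEntropy (x := b / (a + b)) (by positivity)
    (by rw [div_le_iff₀ hs]; linarith)
  have e1 : 1 - b / (a + b) = a / (a + b) := by field_simp; ring
  rw [Real.binEntropy, e1, Real.log_inv, Real.log_inv, Real.log_div hb.ne' hs.ne',
    Real.log_div ha'.ne' hs.ne'] at h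
  have h2 := mul_le_mul_of_nonneg_left h hs.le
  have e2 : (a + b) * (2 * (b / (a + b)) * Real.log 2) = 2 * b * Real.log 2 := by
    field_simp
  have e3 : (a + b) * (b / (a + b) * -(Real.log b - Real.log (a + b)) +
      a / (a + b) * -(Real.log a - Real.log (a + b)))
      = (a + b) * Real.log (a + b) - a * Real.log a - b * Real.log b := by
    field_simp; ring
  rw [e2, e3] at h2
  simp only [Real.logb]
  rw [← sub_nonneg]
  have e4 : (a + b) * (Real.log (a + b) / Real.log 2) -
      (a * (Real.log a / Real.log 2) + b * (Real.log b / Real.log 2) + 2 * b)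
      = ((a + b) * Real.log (a + b) - a * Real.log a - b * Real.log b - 2 * b * Real.log 2)
        / Real.log 2 := by
    field_simp; ring
  rw [e4]
  exact div_nonneg (by linarith) hl.le

lemma spanDeg_split {n : ℕ} (X X₀ X₁ : Finset (Vtx n)) (i : Fin n)
    (hX : ∀ v ∈ X, (v i = false → v ∈ X₀) ∧ (v i = true → v ∈ X₁))
    (h0 : ∀ v ∈ X₀, v ∈ X ∧ v i = false) (h1 : ∀ v ∈ X₁, v ∈ X ∧ v i = true) :
    spanDeg X ≤ spanDeg X₀ + spanDeg X₁ + 2 * min X₀.card X₁.card := by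
  have hdis : Disjoint X₀ X₁ := Finset.disjoint_left.2 fun v hv hv' => by
    have := (h0 v hv).2; rw [(h1 v hv').2] at this; cases this
  have hun : X = X₀ ∪ X₁ := by
    ext v
    rw [Finset.mem_union]
    constructor
    · intro hv
      cases h : v i
      · exact Or.inl ((hX v hv).1 h)
      · exact Or.inr ((hX v hv).2 h)
    · rintro (h | h)
      · exact (h0 v h).1
      · exact (h1 v h).1
  have main : ∀ Y Z : Finset (Vtx n), ∀ b : Bool, (∀ v ∈ Y, v i = b) →
      (∀ v ∈ X, v ∈ Y ∨ v ∈ Z) → (∀ v ∈ Z, v i = !b) →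
      ∑ v ∈ Y, (nbrs v ∩ X).card ≤ spanDeg Y + min Y.card Z.card := by
    intro Y Z b hY hXYZ hZ
    have h2 : ∀ v ∈ Y, (nbrs v ∩ X).card ≤
        (nbrs v ∩ Y).card + if flipAt v i ∈ Z then 1 else 0 := by
      intro v hv
      have hsub : nbrs v ∩ X ⊆ (nbrs v ∩ Y) ∪ (if flipAt v i ∈ Z then {flipAt v i} else ∅) := by
        intro u hu
        rw [Finset.mem_inter] at hu
        rcases hXYZ u hu.2 with h | h
        · exact Finset.mem_union_left _ (Finset.mem_inter.2 ⟨hu.1, h⟩)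
        · refine Finset.mem_union_right _ ?_
          obtain ⟨j, rfl⟩ := mem_nbrs.1 hu.1
          have hj : j = i := by
            by_contra hne
            have := hZ _ h
            rw [flipAt_of_ne v (Ne.symm hne), hY v hv] at this
            cases b <;> simp at this
          subst hj
          simp [h]
      refine (Finset.card_le_card hsub).trans ((Finset.card_union_le _ _).trans ?_)
      split_ifs <;> simp
    refine (Finset.sum_le_sum h2).trans ?_
    rw [Finset.sum_add_distrib, spanDeg, ← Finset.card_filter]
    refine Nat.add_le_add_left (le_min (Finset.card_filter_le _ _) ?_) _
    refine Finset.card_le_card_of_injOn (fun v => flipAt v i) ?_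
      (flipAt_left_injective i).injOn
    intro v hv
    exact (Finset.mem_filter.1 hv).2
  have e : spanDeg X = ∑ v ∈ X₀, (nbrs v ∩ X).card + ∑ v ∈ X₁, (nbrs v ∩ X).card := by
    unfold spanDeg
    rw [← Finset.sum_union hdis, ← hun]
  have m0 := main X₀ X₁ false (fun v hv => (h0 v hv).2)
    (fun v hv => by rw [hun] at hv; exact Finset.mem_union.1 hv)
    (fun v hv => by simpa using (h1 v hv).2)
  have m1 := main X₁ X₀ true (fun v hv => (h1 v hv).2)
    (fun v hv => by rw [hun] at hv; exact (Finset.mem_union.1 hv).symm)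
    (fun v hv => by simpa using (h0 v hv).2)
  rw [min_comm] at m1
  omega

/-- Edge-isoperimetry: a set of `m` vertices of the hypercube spans at most
`(m log₂ m) / 2` edges. -/
theorem spanDeg_le {n : ℕ} (X : Finset (Vtx n)) :
    (spanDeg X : ℝ) ≤ X.card * Real.logb 2 X.card := by
  induction hm : X.card using Nat.strong_induction_on generalizing X with
  | _ m ih =>
  subst hm
  by_cases h : ∃ u ∈ X, ∃ v ∈ X, u ≠ v
  · obtain ⟨u, hu, v, hv, huv⟩ := h
    obtain ⟨i, hi⟩ : ∃ i, u i ≠ v i := by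
      by_contra hne; push Not at hne; exact huv (funext hne)
    set X₀ := X.filter (fun v => v i = false) with hX0
    set X₁ := X.filter (fun v => v i = true) with hX1
    have hs := spanDeg_split X X₀ X₁ i (fun v hv => by simp [hX0, hX1, hv])
      (fun v hv => by simpa [hX0] using hv) (fun v hv => by simpa [hX1] using hv)
    have hcard : X₀.card + X₁.card = X.card := by
      rw [hX0, hX1, ← Finset.card_filter_add_card_filter_not (s := X) (fun v => v i = false)]
      simp
    have hne : X₀.Nonempty ∧ X₁.Nonempty := by
      cases hui : u i <;> cases hvi : v i <;> simp_all
      · exact ⟨⟨u, by simp [hu, hui]⟩, ⟨v, by simp [hv, hvi]⟩⟩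
      · exact ⟨⟨v, by simp [hv, hvi]⟩, ⟨u, by simp [hu, hui]⟩⟩
    have p0 := hne.1.card_pos
    have p1 := hne.2.card_pos
    have i0 := ih _ (by omega) X₀ rfl
    have i1 := ih _ (by omega) X₁ rfl
    have hl := mul_logb_add_mul_logb_le (a := X₀.card) (b := X₁.card) (by positivity)
      (by positivity)
    have hs' : (spanDeg X : ℝ) ≤ spanDeg X₀ + spanDeg X₁ + 2 * min (X₀.card : ℝ) X₁.card := by
      exact_mod_cast hs
    have hc' : (X.card : ℝ) = X₀.card + X₁.card := by exact_mod_cast hcard.symm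
    rw [hc']
    linarith
  · push Not at h
    have : spanDeg X = 0 := by
      unfold spanDeg
      refine Finset.sum_eq_zero fun v hv => ?_
      rw [Finset.card_eq_zero, Finset.eq_empty_iff_forall_notMem]
      intro u hu
      rw [Finset.mem_inter] at hu
      have := h u hu.2 v hv
      subst this
      exact not_mem_nbrs_self u hu.1
    rw [this]
    rcases Nat.eq_zero_or_pos X.card with h0 | h0
    · simp [h0]
    · have : (1 : ℝ) ≤ X.card := by exact_mod_cast h0
      have := Real.logb_nonneg (b := 2) (by norm_num) this
      push_cast
      positivity

/-! ### Edge boundaries -/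

lemma card_le_sum_nbrs_sdiff {n : ℕ} (X : Finset (Vtx n)) (hX : 2 * X.card ≤ 2 ^ n) :
    X.card ≤ ∑ x ∈ X, (nbrs x \ X).card := by
  rcases X.eq_empty_or_nonempty with rfl | hne
  · simp
  have h1 : spanDeg X + ∑ x ∈ X, (nbrs x \ X).card = X.card * n := by
    rw [spanDeg, ← Finset.sum_add_distrib, Finset.sum_const_nat (m := n)]
    intro x _
    rw [Finset.card_inter_add_card_sdiff, card_nbrs]
  have h2 := spanDeg_le X
  have hpos : (0 : ℝ) < X.card := by exact_mod_cast hne.card_pos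
  have h3 : Real.logb 2 X.card ≤ n - 1 := by
    have hX' : (2 * X.card : ℝ) ≤ 2 ^ n := by exact_mod_cast hX
    have := Real.logb_le_logb_of_le (b := 2) (by norm_num) (by positivity) hX'
    rw [Real.logb_mul (by norm_num) hpos.ne', Real.logb_self_eq_one (by norm_num),
      Real.logb_pow, Real.logb_self_eq_one (by norm_num)] at this
    linarith
  have h4 := mul_le_mul_of_nonneg_left h3 hpos.le
  have h1' : (spanDeg X : ℝ) + (∑ x ∈ X, (nbrs x \ X).card : ℕ) = X.card * n := by
    exact_mod_cast h1
  have : (X.card : ℝ) ≤ (∑ x ∈ X, (nbrs x \ X).card : ℕ) := by linarith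
  exact_mod_cast this

lemma sum_nbrs_sdiff_compl {n : ℕ} (X : Finset (Vtx n)) :
    ∑ x ∈ Xᶜ, (nbrs x \ Xᶜ).card = ∑ x ∈ X, (nbrs x \ X).card := by
  have e : ∀ Y : Finset (Vtx n), ∑ x ∈ Y, (nbrs x \ Y).card =
      ∑ x ∈ Y, ∑ y ∈ Yᶜ, if y ∈ nbrs x then 1 else 0 := by
    intro Y
    refine Finset.sum_congr rfl fun x _ => ?_
    rw [← Finset.card_filter]
    congr 1
    ext y
    simp [and_comm]
  rw [e, e, Finset.sum_comm, compl_compl]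
  refine Finset.sum_congr rfl fun x _ => Finset.sum_congr rfl fun y _ => ?_
  simp only [mem_nbrs_comm (u := x)]

/-- A set of vertices of the hypercube has at least as many boundary edges as the smaller of
its two sides has vertices. -/
lemma min_card_le_sum_nbrs_sdiff {n : ℕ} (X : Finset (Vtx n)) :
    min X.card Xᶜ.card ≤ ∑ x ∈ X, (nbrs x \ X).card := by
  have hc : X.card + Xᶜ.card = 2 ^ n := by
    rw [Finset.card_add_card_compl]; simp
  by_cases h : 2 * X.card ≤ 2 ^ n
  · exact (min_le_left _ _).trans (card_le_sum_nbrs_sdiff X h)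
  · rw [← sum_nbrs_sdiff_compl]
    exact (min_le_right _ _).trans (card_le_sum_nbrs_sdiff Xᶜ (by omega))

/-! ### Connected vertex sets -/

/-- A nonempty vertex set inducing a connected subgraph of the hypercube: every proper nonempty
part of it has an edge to the rest. -/
def QConn {n : ℕ} (D : Finset (Vtx n)) : Prop :=
  D.Nonempty ∧ ∀ X ⊆ D, X.Nonempty → X ≠ D → ∃ x ∈ X, ∃ i, flipAt x i ∈ D \ X

/-- Induction along the growth of a connected set, one boundary vertex at a time. -/
theorem QConn.growth {n : ℕ} {D : Finset (Vtx n)} (hD : QConn D) {r : Vtx n} (hr : r ∈ D)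
    (Φ : Finset (Vtx n) → Prop) (h0 : Φ {r})
    (hs : ∀ Z ⊆ D, r ∈ Z → Φ Z → ∀ z ∈ Z, ∀ i, flipAt z i ∈ D \ Z →
      Φ (insert (flipAt z i) Z)) : Φ D := by
  have key : ∀ m : ℕ, ∃ Z ⊆ D, r ∈ Z ∧ Φ Z ∧ (Z = D ∨ m ≤ Z.card) := by
    intro m
    induction m with
    | zero => exact ⟨{r}, by simpa using hr, by simp, h0, Or.inr (Nat.zero_le _)⟩
    | succ m ih =>
      obtain ⟨Z, hZ, hrZ, hΦ, h⟩ := ih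
      by_cases hZD : Z = D
      · exact ⟨Z, hZ, hrZ, hΦ, Or.inl hZD⟩
      · obtain ⟨z, hz, i, hi⟩ := hD.2 Z hZ ⟨r, hrZ⟩ hZD
        refine ⟨insert (flipAt z i) Z, ?_, Finset.mem_insert_of_mem hrZ,
          hs Z hZ hrZ hΦ z hz i hi, Or.inr ?_⟩
        · exact Finset.insert_subset (Finset.mem_sdiff.1 hi).1 hZ
        · rw [Finset.card_insert_of_notMem (Finset.mem_sdiff.1 hi).2]
          have := h.resolve_left hZD
          omega
  obtain ⟨Z, hZ, -, hΦ, h⟩ := key (D.card + 1)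
  rcases h with rfl | h
  · exact hΦ
  · have := Finset.card_le_card hZ
    omega

/-- The union of two connected sets which meet or are joined by an edge is connected. -/
lemma QConn.union {n : ℕ} {Y Z : Finset (Vtx n)} (hY : QConn Y) (hZ : QConn Z) {y z : Vtx n}
    (hy : y ∈ Y) (hz : z ∈ Z) (h : z = y ∨ z ∈ nbrs y) : QConn (Y ∪ Z) := by
  refine ⟨hY.1.mono Finset.subset_union_left, fun X hX hne hXne => ?_⟩
  by_contra hcon
  push Not at hcon
  have part : ∀ T ⊆ Y ∪ Z, QConn T → (∀ v ∈ T, v ∉ X) ∨ T ⊆ X := by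
    intro T hT hTc
    by_contra hboth
    push Not at hboth
    obtain ⟨⟨v, hv, hvX⟩, hTX⟩ := hboth
    obtain ⟨x, hx, i, hi⟩ := hTc.2 (X ∩ T) Finset.inter_subset_right
      ⟨v, Finset.mem_inter.2 ⟨hvX, hv⟩⟩
      (fun e => hTX (by rw [← e]; exact Finset.inter_subset_left))
    rw [Finset.mem_sdiff, Finset.mem_inter] at hi
    refine hcon x (Finset.mem_inter.1 hx).1 i (Finset.mem_sdiff.2 ⟨hT hi.1, ?_⟩)
    exact fun hX' => hi.2 ⟨hX', hi.1⟩
  have cross : ∀ a b : Vtx n, a ∈ X → b ∈ Y ∪ Z → b ∉ X → (b = a ∨ b ∈ nbrs a) → False := by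
    intro a b ha hb hbX hab
    rcases hab with rfl | hab
    · exact hbX ha
    · obtain ⟨i, rfl⟩ := mem_nbrs.1 hab
      exact hcon a ha i (Finset.mem_sdiff.2 ⟨hb, hbX⟩)
  have hyU : y ∈ Y ∪ Z := Finset.mem_union_left _ hy
  have hzU : z ∈ Y ∪ Z := Finset.mem_union_right _ hz
  rcases part Y Finset.subset_union_left hY with hYX | hYX <;>
    rcases part Z Finset.subset_union_right hZ with hZX | hZX
  · obtain ⟨x, hx⟩ := hne
    rcases Finset.mem_union.1 (hX hx) with h' | h'
    · exact hYX x h' hx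
    · exact hZX x h' hx
  · exact cross z y (hZX hz) hyU (hYX y hy)
      (h.imp Eq.symm fun h' => mem_nbrs_comm.1 h')
  · exact cross y z (hYX hy) hzU (hZX z hz) h
  · exact hXne (Finset.Subset.antisymm hX (Finset.union_subset hYX hZX))

/-- The set of vertices visited by the walk from `r` flipping the coordinates listed in `w`. -/
def visited {n : ℕ} : Vtx n → List (Fin n) → Finset (Vtx n)
  | r, [] => {r}
  | r, i :: w => insert r (visited (flipAt r i) w)

lemma exists_visited_insert {n : ℕ} (w : List (Fin n)) (r z : Vtx n) (hz : z ∈ visited r w)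
    (i : Fin n) : ∃ w' : List (Fin n), w'.length = w.length + 2 ∧
      visited r w' = insert (flipAt z i) (visited r w) := by
  induction w generalizing r with
  | nil =>
    have : z = r := by simpa [visited] using hz
    subst this
    refine ⟨[i, i], rfl, ?_⟩
    ext u
    simp [visited, flipAt_flipAt]
  | cons j w ih =>
    by_cases hzr : z = r
    · subst hzr
      refine ⟨i :: i :: j :: w, rfl, ?_⟩
      ext u
      simp [visited, flipAt_flipAt]
    · have hz' : z ∈ visited (flipAt r j) w := by simpa [visited, hzr] using hz
      obtain ⟨w', hl, hw'⟩ := ih _ hz'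
      refine ⟨j :: w', by simp [hl], ?_⟩
      simp only [visited, hw']
      exact Finset.insert_comm _ _ _

lemma QConn.exists_visited {n : ℕ} {D : Finset (Vtx n)} (hD : QConn D) {r : Vtx n} (hr : r ∈ D) :
    ∃ w : List (Fin n), w.length + 2 = 2 * D.card ∧ visited r w = D := by
  refine hD.growth hr (fun Z => ∃ w : List (Fin n), w.length + 2 = 2 * Z.card ∧
    visited r w = Z) ⟨[], by simp, rfl⟩ ?_
  rintro Z - - ⟨w, hl, rfl⟩ z hz i hi
  obtain ⟨w', hl', hw'⟩ := exists_visited_insert w r z hz i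
  refine ⟨w', ?_, hw'⟩
  rw [Finset.card_insert_of_notMem (Finset.mem_sdiff.1 hi).2, hl']
  omega

/-- There are at most `2 ^ n * n ^ (2 * d)` connected sets of size `d` in the hypercube. -/
lemma card_qconn_le {n : ℕ} (hn : 1 ≤ n) (d : ℕ) :
    (Finset.univ.filter fun D : Finset (Vtx n) => QConn D ∧ D.card = d).card ≤
      2 ^ n * n ^ (2 * d) := by
  have hsub : (Finset.univ.filter fun D : Finset (Vtx n) => QConn D ∧ D.card = d) ⊆
      (Finset.univ : Finset (Vtx n × (Fin (2 * d - 2) → Fin n))).image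
        (fun p => visited p.1 (List.ofFn p.2)) := by
    intro D hD
    obtain ⟨hc, hd⟩ := (Finset.mem_filter.1 hD).2
    obtain ⟨r, hr⟩ := hc.1
    obtain ⟨w, hl, hw⟩ := hc.exists_visited hr
    have hlen : w.length = 2 * d - 2 := by omega
    rw [Finset.mem_image]
    refine ⟨(r, fun j => w.get (Fin.cast hlen.symm j)), Finset.mem_univ _, ?_⟩
    rw [← hw]
    congr 1
    refine List.ext_getElem (by simp [hlen]) fun a h1 h2 => ?_
    simp
  refine (Finset.card_le_card hsub).trans (Finset.card_image_le.trans ?_)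
  rw [Finset.card_univ, Fintype.card_prod]
  simp only [Fintype.card_pi, Fintype.card_bool, Fintype.card_fin, Finset.prod_const,
    Finset.card_univ]
  exact Nat.mul_le_mul_left _ (Nat.pow_le_pow_right hn (Nat.sub_le _ _))

/-! ### Uniform probability on finite spaces -/

lemma prob_eq {Ω : Type*} [Fintype Ω] (p : Ω → Prop) [DecidablePred p] :
    prob p = ((Finset.univ.filter p).card : ℝ) / Fintype.card Ω := by
  rw [prob, Nat.card_eq_fintype_card, Nat.card_eq_fintype_card, Fintype.card_subtype]

lemma prob_mono {Ω : Type*} [Fintype Ω] {p q : Ω → Prop} (h : ∀ ω, p ω → q ω) :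
    prob p ≤ prob q := by
  rw [prob_eq, prob_eq]
  gcongr with ω
  exact h ω

lemma prob_le_one {Ω : Type*} [Fintype Ω] (p : Ω → Prop) : prob p ≤ 1 := by
  rw [prob_eq]
  refine div_le_one_of_le₀ ?_ (by positivity)
  exact_mod_cast Finset.card_filter_le _ _

lemma prob_add_prob_not {Ω : Type*} [Fintype Ω] [Nonempty Ω] (p : Ω → Prop) :
    prob p + prob (fun ω => ¬ p ω) = 1 := by
  have h : (Fintype.card Ω : ℝ) ≠ 0 := by exact_mod_cast Fintype.card_ne_zero
  rw [prob_eq, prob_eq, ← add_div, div_eq_one_iff_eq h]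
  have := Finset.card_filter_add_card_filter_not (s := Finset.univ) p
  rw [Finset.card_univ] at this
  rw [← this]
  push_cast
  congr!

lemma prob_or_le {Ω : Type*} [Fintype Ω] (p q : Ω → Prop) :
    prob (fun ω => p ω ∨ q ω) ≤ prob p + prob q := by
  rw [prob_eq, prob_eq, prob_eq, ← add_div]
  gcongr
  have : (Finset.univ.filter fun ω => p ω ∨ q ω) ⊆
      Finset.univ.filter p ∪ Finset.univ.filter q := by
    intro ω hω
    simpa using hω
  exact_mod_cast (Finset.card_le_card this).trans (Finset.card_union_le _ _)

lemma prob_exists_le_sum {Ω α : Type*} [Fintype Ω] (A : Finset α) (p : α → Ω → Prop) :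
    prob (fun ω => ∃ a ∈ A, p a ω) ≤ ∑ a ∈ A, prob (p a) := by
  simp only [prob_eq]
  rw [← Finset.sum_div]
  gcongr
  have : (Finset.univ.filter fun ω => ∃ a ∈ A, p a ω) ⊆
      A.biUnion fun a => Finset.univ.filter (p a) := by
    intro ω hω
    simpa using hω
  exact_mod_cast (Finset.card_le_card this).trans Finset.card_biUnion_le

lemma prob_exists_le {Ω α : Type*} [Fintype Ω] (A : Finset α) (p : α → Ω → Prop) (c : ℝ)
    (h : ∀ a ∈ A, prob (p a) ≤ c) : prob (fun ω => ∃ a ∈ A, p a ω) ≤ A.card * c := by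
  refine (prob_exists_le_sum A p).trans ((Finset.sum_le_sum h).trans ?_)
  rw [Finset.sum_const, nsmul_eq_mul]

/-! ### Counting choices in the `k`-out model -/

/-- The set of possible choices of a vertex `v` in the `k`-out model. -/
abbrev Choice {n : ℕ} (k : ℕ) (v : Vtx n) :=
  {s : Finset (Vtx n) // s.card = k ∧ ∀ u ∈ s, (cubeGraph n).Adj v u}

lemma choice_subset_nbrs {n k : ℕ} {v : Vtx n} (s : Choice k v) : s.1 ⊆ nbrs v :=
  fun u hu => adj_iff_mem_nbrs.1 (s.2.2 u hu)

lemma card_choice_subset {n k : ℕ} (v : Vtx n) (R : Finset (Vtx n)) :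
    (Finset.univ.filter fun s : Choice k v => s.1 ⊆ R).card =
      ((nbrs v ∩ R).card).choose k := by
  rw [← Finset.card_powersetCard]
  refine Finset.card_bij (fun s _ => s.1) ?_ (fun _ _ _ _ h => Subtype.ext h) ?_
  · intro s hs
    rw [Finset.mem_powersetCard]
    exact ⟨Finset.subset_inter (choice_subset_nbrs s) (Finset.mem_filter.1 hs).2, s.2.1⟩
  · intro t ht
    rw [Finset.mem_powersetCard, Finset.subset_inter_iff] at ht
    exact ⟨⟨t, ht.2, fun u hu => adj_iff_mem_nbrs.2 (ht.1.1 hu)⟩,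
      Finset.mem_filter.2 ⟨Finset.mem_univ _, ht.1.2⟩, rfl⟩

lemma card_choice {n : ℕ} (k : ℕ) (v : Vtx n) : Fintype.card (Choice k v) = n.choose k := by
  have := card_choice_subset (k := k) v Finset.univ
  simpa [card_nbrs] using this

lemma choose_mul_pow_le {m n : ℕ} (h : m ≤ n) (k : ℕ) :
    m.choose k * n ^ k ≤ n.choose k * m ^ k := by
  induction k with
  | zero => simp
  | succ k ih =>
    have h1 : (m - k) * n ≤ (n - k) * m := by
      rw [Nat.sub_mul, Nat.sub_mul, mul_comm n m]
      exact Nat.sub_le_sub_left (Nat.mul_le_mul_left _ h) _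
    refine Nat.le_of_mul_le_mul_right ?_ (Nat.succ_pos k)
    calc m.choose (k + 1) * n ^ (k + 1) * (k + 1)
        = (m.choose (k + 1) * (k + 1)) * n ^ k * n := by ring
      _ = (m.choose k * n ^ k) * ((m - k) * n) := by rw [Nat.choose_succ_right_eq]; ring
      _ ≤ (n.choose k * m ^ k) * ((n - k) * m) := Nat.mul_le_mul ih h1
      _ = (n.choose (k + 1) * (k + 1)) * m ^ k * m := by rw [Nat.choose_succ_right_eq]; ring
      _ = n.choose (k + 1) * m ^ (k + 1) * (k + 1) := by ring

lemma choose_div_choose_le {m n k : ℕ} (h : m ≤ n) (hk : k ≤ n) :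
    (m.choose k : ℝ) / n.choose k ≤ ((m : ℝ) / n) ^ k := by
  rcases Nat.eq_zero_or_pos n with rfl | hn
  · obtain rfl : k = 0 := by omega
    simp
  have h1 : (0 : ℝ) < n.choose k := by exact_mod_cast Nat.choose_pos hk
  have h2 : (0 : ℝ) < n := by exact_mod_cast hn
  rw [div_pow, div_le_div_iff₀ h1 (by positivity), mul_comm ((m : ℝ) ^ k)]
  exact_mod_cast choose_mul_pow_le h k

lemma prod_le_mean_pow {ι : Type*} (D : Finset ι) (hD : D.Nonempty) (z : ι → ℝ)
    (hz : ∀ i ∈ D, 0 ≤ z i) : ∏ i ∈ D, z i ≤ ((∑ i ∈ D, z i) / D.card) ^ D.card := by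
  have hpos : (0 : ℝ) < D.card := by exact_mod_cast hD.card_pos
  have h := Real.geom_mean_le_arith_mean_weighted D (fun _ => (1 : ℝ) / D.card) z
    (fun _ _ => by positivity) (by rw [Finset.sum_const, nsmul_eq_mul]; field_simp) hz
  have h0 : 0 ≤ ∏ i ∈ D, z i ^ ((1 : ℝ) / D.card) :=
    Finset.prod_nonneg fun i hi => Real.rpow_nonneg (hz i hi) _
  have h2 := pow_le_pow_left₀ h0 h D.card
  rw [← Finset.prod_pow, ← Finset.mul_sum] at h2
  have e : ∏ i ∈ D, (z i ^ ((1 : ℝ) / D.card)) ^ D.card = ∏ i ∈ D, z i := by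
    refine Finset.prod_congr rfl fun i hi => ?_
    rw [← Real.rpow_natCast, ← Real.rpow_mul (hz i hi), one_div, inv_mul_cancel₀ hpos.ne',
      Real.rpow_one]
  rw [e, one_div, inv_mul_eq_div] at h2
  exact h2

lemma prob_choices_subset_le {n k : ℕ} (hk : k ≤ n) (hn : 1 ≤ n) (D R : Finset (Vtx n))
    (hD : D.Nonempty) :
    prob (fun ω : KOut n k => ∀ v ∈ D, (ω v).1 ⊆ R) ≤
      (((∑ v ∈ D, (nbrs v ∩ R).card : ℕ) : ℝ) / (D.card * n)) ^ (k * D.card) := by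
  have hset : (Finset.univ.filter fun ω : KOut n k => ∀ v ∈ D, (ω v).1 ⊆ R) =
      Fintype.piFinset fun v => Finset.univ.filter fun s : Choice k v => v ∈ D → s.1 ⊆ R := by
    ext ω
    simp [Fintype.mem_piFinset]
  have hc : (0 : ℝ) < n.choose k := by exact_mod_cast Nat.choose_pos hk
  have hn' : (0 : ℝ) < n := by exact_mod_cast hn
  have hp : prob (fun ω : KOut n k => ∀ v ∈ D, (ω v).1 ⊆ R) =
      ∏ v ∈ D, (((nbrs v ∩ R).card.choose k : ℝ) / n.choose k) := by
    rw [prob_eq, hset, Fintype.card_piFinset, Fintype.card_pi, Nat.cast_prod, Nat.cast_prod,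
      ← Finset.prod_div_distrib, ← Finset.prod_subset (Finset.subset_univ D)]
    · refine Finset.prod_congr rfl fun v hv => ?_
      rw [card_choice]
      simp only [hv, forall_const]
      rw [card_choice_subset]
    · intro v _ hv
      rw [card_choice]
      simp only [hv, false_imp_iff, Finset.filter_true, Finset.card_univ]
      rw [card_choice, div_self hc.ne']
  rw [hp]
  have hD' : (0 : ℝ) < D.card := by exact_mod_cast hD.card_pos
  calc ∏ v ∈ D, (((nbrs v ∩ R).card.choose k : ℝ) / n.choose k)
      ≤ ∏ v ∈ D, (((nbrs v ∩ R).card : ℝ) / n) ^ k := by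
        refine Finset.prod_le_prod (fun v _ => by positivity) fun v _ => ?_
        refine choose_div_choose_le ?_ hk
        exact (Finset.card_le_card Finset.inter_subset_left).trans (card_nbrs v).le
    _ = (∏ v ∈ D, (((nbrs v ∩ R).card : ℝ) / n)) ^ k := Finset.prod_pow _ _ _
    _ ≤ (((∑ v ∈ D, (((nbrs v ∩ R).card : ℝ) / n)) / D.card) ^ D.card) ^ k := by
        refine pow_le_pow_left₀ (Finset.prod_nonneg fun v _ => by positivity) ?_ k
        exact prod_le_mean_pow D hD _ fun v _ => by positivity
    _ = _ := by
        rw [← pow_mul, mul_comm D.card k, ← Finset.sum_div, div_div, mul_comm (n : ℝ)]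
        push_cast
        rfl

/-! ### Closed connected sets: the first moment bound -/

/-- Some connected set of `d` vertices makes all its choices inside itself and a set of at most
`r` further vertices. -/
def HasClosed {n : ℕ} (k r d : ℕ) (ω : KOut n k) : Prop :=
  ∃ D T : Finset (Vtx n), QConn D ∧ D.card = d ∧ T.card ≤ r ∧ ∀ v ∈ D, (ω v).1 ⊆ D ∪ T

lemma exists_fin_cover {α : Type*} [DecidableEq α] {r : ℕ} (T : Finset α) (hT : T.card ≤ r)
    (a : α) :
    ∃ f : Fin r → α, (∀ i, f i = a ∨ f i ∈ T) ∧ T ⊆ Finset.univ.image f := by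
  refine ⟨fun i => if h : i.1 < T.card then (T.equivFin.symm ⟨i.1, h⟩).1 else a, ?_, ?_⟩
  · intro i
    dsimp only
    split_ifs with h
    · exact Or.inr (T.equivFin.symm ⟨i.1, h⟩).2
    · exact Or.inl rfl
  · intro x hx
    rw [Finset.mem_image]
    refine ⟨⟨(T.equivFin ⟨x, hx⟩).1, (T.equivFin ⟨x, hx⟩).2.trans_le hT⟩, Finset.mem_univ _, ?_⟩
    simp

lemma card_image_fin_le {α : Type*} [DecidableEq α] {r : ℕ} (f : Fin r → α) :
    (Finset.univ.image f).card ≤ r :=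
  Finset.card_image_le.trans (by rw [Finset.card_univ, Fintype.card_fin])

lemma mul_logb_le_mul_logb {a b : ℕ} (ha : 1 ≤ a) (hab : a ≤ b) :
    (a : ℝ) * Real.logb 2 a ≤ b * Real.logb 2 b := by
  have h1 : (1 : ℝ) ≤ a := by exact_mod_cast ha
  have h2 : (a : ℝ) ≤ b := by exact_mod_cast hab
  exact mul_le_mul h2 (Real.logb_le_logb_of_le (by norm_num) (by linarith) h2)
    (Real.logb_nonneg (by norm_num) h1) (by linarith)

lemma sum_nbrs_inter_union_le {n r : ℕ} (D T : Finset (Vtx n)) (hD : D.Nonempty)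
    (hT : T.card ≤ r) : ((∑ v ∈ D, (nbrs v ∩ (D ∪ T)).card : ℕ) : ℝ) ≤
      (D.card + r : ℕ) * Real.logb 2 (D.card + r : ℕ) := by
  have h1 : ∑ v ∈ D, (nbrs v ∩ (D ∪ T)).card ≤ spanDeg (D ∪ T) :=
    Finset.sum_le_sum_of_subset Finset.subset_union_left
  have h2 := spanDeg_le (D ∪ T)
  have h3 : 1 ≤ (D ∪ T).card := (hD.mono Finset.subset_union_left).card_pos
  have h4 : (D ∪ T).card ≤ D.card + r := (Finset.card_union_le _ _).trans (by omega)
  refine le_trans ?_ (h2.trans (mul_logb_le_mul_logb h3 h4))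
  exact_mod_cast h1

lemma prob_choices_subset_union_le {n k r : ℕ} (hk : k ≤ n) (hn : 1 ≤ n) (D T : Finset (Vtx n))
    (hD : D.Nonempty) (hT : T.card ≤ r) :
    prob (fun ω : KOut n k => ∀ v ∈ D, (ω v).1 ⊆ D ∪ T) ≤
      (((D.card + r : ℕ) * Real.logb 2 (D.card + r : ℕ)) / (D.card * n)) ^ (k * D.card) := by
  refine (prob_choices_subset_le hk hn D _ hD).trans ?_
  have h := sum_nbrs_inter_union_le D T hD hT
  have h0 : (0 : ℝ) ≤ ((∑ v ∈ D, (nbrs v ∩ (D ∪ T)).card : ℕ) : ℝ) / (D.card * n) := by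
    positivity
  refine pow_le_pow_left₀ h0 ?_ _
  exact div_le_div_of_nonneg_right h (by positivity)

theorem prob_hasClosed_le {n k r d : ℕ} (hk : k ≤ n) (hn : 1 ≤ n) (hd : 1 ≤ d) :
    prob (fun ω : KOut n k => HasClosed k r d ω) ≤
      2 ^ n * n ^ (2 * d) * (d * (n + 1)) ^ r *
        (((d + r : ℕ) * Real.logb 2 (d + r : ℕ)) / (d * n)) ^ (k * d) := by
  set c : ℝ := (((d + r : ℕ) * Real.logb 2 (d + r : ℕ)) / (d * n)) ^ (k * d) with hc
  have hc0 : 0 ≤ c := by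
    have h1 : (1 : ℝ) ≤ (d + r : ℕ) := by exact_mod_cast (by omega : 1 ≤ d + r)
    have := Real.logb_nonneg (b := 2) (by norm_num) h1
    positivity
  set 𝒟 := Finset.univ.filter fun D : Finset (Vtx n) => QConn D ∧ D.card = d
  set N : Finset (Vtx n) → Finset (Vtx n) := fun D => D ∪ D.biUnion nbrs with hN
  have hNcard : ∀ D ∈ 𝒟, (N D).card ≤ d * (n + 1) := by
    intro D hD
    have hd' := (Finset.mem_filter.1 hD).2.2
    refine (Finset.card_union_le _ _).trans ?_
    have := Finset.card_biUnion_le_card_mul D nbrs n fun v _ => (card_nbrs v).le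
    rw [hd'] at this ⊢
    nlinarith
  have step : ∀ ω : KOut n k, HasClosed k r d ω → ∃ D ∈ 𝒟,
      ∃ f ∈ Fintype.piFinset (fun _ : Fin r => N D),
        ∀ v ∈ D, (ω v).1 ⊆ D ∪ Finset.univ.image f := by
    rintro ω ⟨D, T, hDc, hDd, hT, hcl⟩
    obtain ⟨a, ha⟩ := hDc.1
    obtain ⟨f, hf1, hf2⟩ := exists_fin_cover (r := r) (T ∩ N D)
      ((Finset.card_le_card Finset.inter_subset_left).trans hT) a
    refine ⟨D, Finset.mem_filter.2 ⟨Finset.mem_univ _, hDc, hDd⟩, f, ?_, ?_⟩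
    · rw [Fintype.mem_piFinset]
      intro i
      rcases hf1 i with h | h
      · rw [h]; exact Finset.mem_union_left _ ha
      · exact (Finset.mem_inter.1 h).2
    · intro v hv u hu
      rcases Finset.mem_union.1 (hcl v hv hu) with h | h
      · exact Finset.mem_union_left _ h
      · refine Finset.mem_union_right _ (hf2 (Finset.mem_inter.2 ⟨h, ?_⟩))
        exact Finset.mem_union_right _ (Finset.mem_biUnion.2 ⟨v, hv, choice_subset_nbrs (ω v) hu⟩)
  refine (prob_mono step).trans ((prob_exists_le 𝒟 _ (((d * (n + 1)) ^ r : ℕ) * c) ?_).trans ?_)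
  · intro D hD
    obtain ⟨hDc, hDd⟩ := (Finset.mem_filter.1 hD).2
    refine (prob_exists_le _ _ c ?_).trans ?_
    · intro f _
      rw [hc, ← hDd]
      exact prob_choices_subset_union_le hk hn D _ hDc.1 (card_image_fin_le f)
    · refine mul_le_mul_of_nonneg_right ?_ hc0
      rw [Fintype.card_piFinset, Finset.prod_const, Finset.card_univ, Fintype.card_fin]
      exact_mod_cast Nat.pow_le_pow_left (hNcard D hD) r
  · rw [← mul_assoc]
    refine mul_le_mul_of_nonneg_right ?_ hc0
    push_cast
    gcongr
    exact_mod_cast card_qconn_le hn d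

/-! ### Small closed sets -/

lemma sum_nbrs_inter_comm {n : ℕ} (X Y : Finset (Vtx n)) :
    ∑ v ∈ X, (nbrs v ∩ Y).card = ∑ v ∈ Y, (nbrs v ∩ X).card := by
  have key : ∀ A B : Finset (Vtx n), ∑ v ∈ A, (nbrs v ∩ B).card =
      ∑ v ∈ A, ∑ u ∈ B, if u ∈ nbrs v then 1 else 0 := fun A B =>
    Finset.sum_congr rfl fun v _ => by
      rw [Finset.sum_boole, Finset.inter_comm, ← Finset.filter_mem_eq_inter]; rfl
  rw [key, key, Finset.sum_comm]
  refine Finset.sum_congr rfl fun v _ => Finset.sum_congr rfl fun u _ => ?_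
  simp only [mem_nbrs_comm (u := v) (v := u)]

lemma two_mul_sum_nbrs_inter_union_le {n : ℕ} {D S : Finset (Vtx n)} (hDS : Disjoint D S) :
    2 * ∑ v ∈ D, (nbrs v ∩ (D ∪ S)).card ≤ spanDeg D + spanDeg (D ∪ S) := by
  have h1 : ∀ v, (nbrs v ∩ (D ∪ S)).card = (nbrs v ∩ D).card + (nbrs v ∩ S).card := fun v => by
    rw [Finset.inter_union_distrib_left, Finset.card_union_of_disjoint]
    exact hDS.mono Finset.inter_subset_right Finset.inter_subset_right
  have h2 : spanDeg (D ∪ S) = ∑ v ∈ D, (nbrs v ∩ (D ∪ S)).card +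
      ∑ v ∈ S, (nbrs v ∩ (D ∪ S)).card := by
    rw [spanDeg, Finset.sum_union hDS]
  have h3 := sum_nbrs_inter_comm D S
  simp only [h1, Finset.sum_add_distrib] at h2 ⊢
  unfold spanDeg at h2 ⊢
  omega

lemma add_mul_logb_le {d s : ℝ} (hd : 1 ≤ d) (hs : 0 ≤ s) :
    (d + s) * Real.logb 2 (d + s) ≤ (d + s) * Real.logb 2 d + 2 * (s + s ^ 2 / d) := by
  have hd0 : 0 < d := by linarith
  have e : d + s = d * (1 + s / d) := by field_simp
  have hsd : 0 ≤ s / d := by positivity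
  have h1 : Real.logb 2 (d + s) = Real.logb 2 d + Real.logb 2 (1 + s / d) := by
    conv_lhs => rw [e]
    rw [Real.logb_mul hd0.ne' (by linarith)]
  have h2 : Real.logb 2 (1 + s / d) ≤ 2 * (s / d) := by
    rw [Real.logb, div_le_iff₀ (Real.log_pos (by norm_num))]
    have := Real.log_le_sub_one_of_pos (show 0 < 1 + s / d by linarith)
    have := Real.log_two_gt_d9
    nlinarith
  have h3 : (d + s) * Real.logb 2 (1 + s / d) ≤ (d + s) * (2 * (s / d)) :=
    mul_le_mul_of_nonneg_left h2 (by linarith)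
  have h4 : (d + s) * (2 * (s / d)) = 2 * (s + s ^ 2 / d) := by field_simp
  rw [h1, mul_add]
  linarith

lemma sq_add_le_of_le_logb {k d : ℝ} (hk : 128 ≤ k) (hd : 1 ≤ d) (h : k / 8 ≤ Real.logb 2 d) :
    k ^ 2 + 3 * k < d := by
  have h1 : (2 : ℝ) ^ (k / 8) ≤ d := (Real.le_logb_iff_rpow_le (by norm_num) (by linarith)).1 h
  refine lt_of_lt_of_le ?_ h1
  have e : (2 : ℝ) ^ (k / 8) = 65536 * Real.exp ((k / 8 - 16) * Real.log 2) := by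
    have : k / 8 = 16 + (k / 8 - 16) := by ring
    rw [this, Real.rpow_add (by norm_num), Real.rpow_def_of_pos (by norm_num) (_ - _)]
    have : (2 : ℝ) ^ (16 : ℝ) = 65536 := by norm_num
    rw [this]
    ring_nf
  rw [e]
  have h2 := Real.log_two_gt_d9
  have h3 := Real.quadratic_le_exp_of_nonneg (x := (k / 8 - 16) * Real.log 2)
    (mul_nonneg (by linarith) (by linarith))
  have h4 : 1 + (k / 8 - 16) / 2 + ((k / 8 - 16) / 2) ^ 2 / 2 ≤
      Real.exp ((k / 8 - 16) * Real.log 2) := by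
    refine le_trans ?_ h3
    have : (k / 8 - 16) / 2 ≤ (k / 8 - 16) * Real.log 2 := by nlinarith
    have h0 : 0 ≤ (k / 8 - 16) / 2 := by linarith
    have := pow_le_pow_left₀ h0 this 2
    linarith
  nlinarith

lemma le_card_of_small_logb {n : ℕ} {k : ℕ} (hk : 128 ≤ k) {D S : Finset (Vtx n)}
    (hD : D.Nonempty) (h : ∀ v ∈ D, k ≤ (nbrs v ∩ (D ∪ S)).card)
    (hd : Real.logb 2 D.card < (k : ℝ) / 8) :
    k ≤ S.card := by
  have hun : ∀ v ∈ D, k ≤ (nbrs v ∩ D).card + (nbrs v ∩ S).card := fun v hv => by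
    refine (h v hv).trans ?_
    rw [Finset.inter_union_distrib_left]
    exact Finset.card_union_le _ _
  obtain ⟨v, hv⟩ := hD
  by_cases h1 : D = {v}
  · have h2 := hun v hv
    have h3 : nbrs v ∩ D = ∅ := by
      rw [h1, Finset.inter_singleton_of_notMem (not_mem_nbrs_self v)]
    rw [h3, Finset.card_empty, zero_add] at h2
    exact h2.trans (Finset.card_le_card Finset.inter_subset_right)
  have hD2 : 2 ≤ D.card := by
    by_contra hlt
    have : D.card = 1 := by
      have := Finset.card_pos.2 ⟨v, hv⟩
      omega
    obtain ⟨a, ha⟩ := Finset.card_eq_one.1 this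
    rw [ha, Finset.mem_singleton] at hv
    subst hv
    exact h1 ha
  set G := D.filter fun v => 4 * (nbrs v ∩ D).card ≤ k with hG
  have hG2 : 1 < G.card := by
    by_contra hlt
    push Not at hlt
    have h4 : (D.filter fun v => ¬ 4 * (nbrs v ∩ D).card ≤ k).card = D.card - G.card := by
      have : G.card + (D.filter fun v => ¬ 4 * (nbrs v ∩ D).card ≤ k).card = D.card := by
        rw [hG]
        exact Finset.card_filter_add_card_filter_not _
      omega
    have h5 : (D.card - G.card) * k ≤ 4 * spanDeg D := by
      rw [← h4, ← smul_eq_mul, ← Finset.sum_const, spanDeg, Finset.mul_sum]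
      refine (Finset.sum_le_sum fun v hv => ?_).trans
        (Finset.sum_le_sum_of_subset (Finset.filter_subset _ _))
      have := (Finset.mem_filter.1 hv).2
      omega
    have h6 := spanDeg_le D
    have h7 : D.card * k ≤ 8 * spanDeg D := by
      have : D.card ≤ 2 * (D.card - G.card) := by omega
      calc D.card * k ≤ 2 * (D.card - G.card) * k := Nat.mul_le_mul_right _ this
        _ ≤ _ := by rw [mul_assoc]; omega
    have h8 : (D.card : ℝ) * k ≤ 8 * spanDeg D := by exact_mod_cast h7
    have h9 : (0 : ℝ) < D.card := by exact_mod_cast (by omega : 0 < D.card)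
    nlinarith
  obtain ⟨a, ha, b, hb, hab⟩ := Finset.one_lt_card.1 hG2
  rw [hG, Finset.mem_filter] at ha hb
  have ka := hun a ha.1
  have kb := hun b hb.1
  have h10 := card_common_nbrs_le hab
  have h11 := Finset.card_union_add_card_inter (nbrs a ∩ S) (nbrs b ∩ S)
  have h12 : ((nbrs a ∩ S) ∩ (nbrs b ∩ S)).card ≤ (nbrs a ∩ nbrs b).card :=
    Finset.card_le_card (Finset.inter_subset_inter Finset.inter_subset_left
      Finset.inter_subset_left)
  have h13 : ((nbrs a ∩ S) ∪ (nbrs b ∩ S)).card ≤ S.card :=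
    Finset.card_le_card (Finset.union_subset Finset.inter_subset_right Finset.inter_subset_right)
  omega

theorem lt_logb_card_of_closed {n : ℕ} {k : ℕ} (hk : 128 ≤ k) {D S : Finset (Vtx n)}
    (hD : D.Nonempty) (hS : S.card < k) (hDS : Disjoint D S)
    (h : ∀ v ∈ D, k ≤ (nbrs v ∩ (D ∪ S)).card) : (k : ℝ) - 1 / 2 < Real.logb 2 D.card := by
  by_contra hlt
  push Not at hlt
  rcases lt_or_ge (Real.logb 2 D.card) ((k : ℝ) / 8) with h8 | h8
  · exact absurd (le_card_of_small_logb hk hD h h8) (by omega)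
  have hk' : (128 : ℝ) ≤ k := by exact_mod_cast hk
  have hd1 : (1 : ℝ) ≤ D.card := by exact_mod_cast hD.card_pos
  have h9 := sq_add_le_of_le_logb hk' hd1 h8
  have h1 : 2 * (k * D.card) ≤ spanDeg D + spanDeg (D ∪ S) := by
    refine le_trans ?_ (two_mul_sum_nbrs_inter_union_le hDS)
    have := Finset.card_nsmul_le_sum D _ k h
    rw [smul_eq_mul] at this
    linarith
  have h1' : (2 : ℝ) * (k * D.card) ≤ spanDeg D + spanDeg (D ∪ S) := by exact_mod_cast h1
  have h2 := spanDeg_le D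
  have h3 := spanDeg_le (D ∪ S)
  rw [Finset.card_union_of_disjoint hDS, Nat.cast_add] at h3
  have h4 := add_mul_logb_le hd1 (Nat.cast_nonneg S.card)
  have hs : (S.card : ℝ) ≤ k - 1 := by
    have : S.card + 1 ≤ k := hS
    have : (S.card : ℝ) + 1 ≤ k := by exact_mod_cast this
    linarith
  have hs0 : (0 : ℝ) ≤ S.card := Nat.cast_nonneg _
  set d := (D.card : ℝ)
  set s := (S.card : ℝ)
  set κ := (k : ℝ)
  have h5 : s ^ 2 / d ≤ 1 := by
    rw [div_le_one (by linarith)]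
    nlinarith
  have h6 : d * Real.logb 2 d ≤ d * (κ - 1 / 2) := mul_le_mul_of_nonneg_left hlt (by linarith)
  have h7 : s * Real.logb 2 d ≤ s * (κ - 1 / 2) := mul_le_mul_of_nonneg_left hlt hs0
  nlinarith

/-! ### Cuts, blocks and components -/

/-- The set `Y` avoids `S` and all choices of its members stay inside `Y ∪ S`. -/
def IsClosedOff {n : ℕ} (f : Vtx n → Finset (Vtx n)) (S Y : Finset (Vtx n)) : Prop :=
  ∀ v ∈ Y, v ∉ S ∧ f v ⊆ Y ∪ S

/-- `A` and `B` partition the complement of `S` and no choice goes from one to the other. -/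
structure IsCut {n : ℕ} (g : Vtx n → Finset (Vtx n)) (S A B : Finset (Vtx n)) : Prop where
  cover : ∀ v, v ∉ S → v ∈ A ∨ v ∈ B
  avoid_left : ∀ v ∈ A, v ∉ S
  avoid_right : ∀ v ∈ B, v ∉ S
  disj : ∀ v ∈ A, v ∉ B
  left : ∀ v ∈ A, ∀ u ∈ g v, u ∉ B
  right : ∀ v ∈ B, ∀ u ∈ g v, u ∉ A

lemma IsCut.symm {n : ℕ} {g : Vtx n → Finset (Vtx n)} {S A B : Finset (Vtx n)}
    (h : IsCut g S A B) : IsCut g S B A :=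
  ⟨fun v hv => (h.cover v hv).symm, h.avoid_right, h.avoid_left,
    fun v hv hv' => h.disj v hv' hv, h.right, h.left⟩

/-- A small connected closed set. -/
def IsSmallClosed {n : ℕ} (f : Vtx n → Finset (Vtx n)) (S : Finset (Vtx n)) (M : ℕ)
    (Y : Finset (Vtx n)) : Prop :=
  QConn Y ∧ IsClosedOff f S Y ∧ Y.card < M

/-- `Bk` assigns to every vertex of `W` a maximal small connected closed set containing it. -/
structure IsBlocks {n : ℕ} (f : Vtx n → Finset (Vtx n)) (S : Finset (Vtx n)) (M : ℕ)
    (W : Finset (Vtx n)) (Bk : Vtx n → Finset (Vtx n)) : Prop where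
  small : ∀ v ∈ W, IsSmallClosed f S M (Bk v)
  mem : ∀ v ∈ W, v ∈ Bk v
  subset : ∀ Y, IsSmallClosed f S M Y → Y ⊆ W
  eq : ∀ v ∈ W, ∀ u ∈ Bk v, ∀ w ∈ W, (w = u ∨ w ∈ nbrs u) → Bk w = Bk v

lemma IsClosedOff.union {n : ℕ} {f : Vtx n → Finset (Vtx n)} {S Y Z : Finset (Vtx n)}
    (hY : IsClosedOff f S Y) (hZ : IsClosedOff f S Z) : IsClosedOff f S (Y ∪ Z) := by
  intro v hv
  rcases Finset.mem_union.1 hv with h | h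
  · exact ⟨(hY v h).1, (hY v h).2.trans
      (Finset.union_subset_union_left Finset.subset_union_left)⟩
  · exact ⟨(hZ v h).1, (hZ v h).2.trans
      (Finset.union_subset_union_left Finset.subset_union_right)⟩

theorem exists_blocks {n : ℕ} (f : Vtx n → Finset (Vtx n)) (S : Finset (Vtx n)) (M L : ℕ)
    (hML : 2 * M ≤ L)
    (hgap : ∀ D, QConn D → IsClosedOff f S D → M ≤ D.card → L < D.card) :
    ∃ W Bk, IsBlocks f S M W Bk := by
  set W : Finset (Vtx n) := Finset.univ.filter fun v => ∃ Y, IsSmallClosed f S M Y ∧ v ∈ Y with hW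
  have key : ∀ v, ∃ Y, v ∈ W → IsSmallClosed f S M Y ∧ v ∈ Y ∧
      ∀ Z, IsSmallClosed f S M Z → v ∈ Z → Z.card ≤ Y.card := by
    intro v
    by_cases hv : v ∈ W
    · obtain ⟨Y, hY, hvY⟩ := (Finset.mem_filter.1 hv).2
      obtain ⟨Z, hZ, hmax⟩ := Finset.exists_max_image
        (Finset.univ.filter fun Y => IsSmallClosed f S M Y ∧ v ∈ Y) Finset.card
        ⟨Y, Finset.mem_filter.2 ⟨Finset.mem_univ _, hY, hvY⟩⟩
      exact ⟨Z, fun _ => ⟨(Finset.mem_filter.1 hZ).2.1, (Finset.mem_filter.1 hZ).2.2,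
        fun T hT hvT => hmax T (Finset.mem_filter.2 ⟨Finset.mem_univ _, hT, hvT⟩)⟩⟩
    · exact ⟨∅, fun h => absurd h hv⟩
  choose Bk hBk using key
  refine ⟨W, Bk, fun v hv => (hBk v hv).1, fun v hv => (hBk v hv).2.1, fun Y hY v hv =>
    Finset.mem_filter.2 ⟨Finset.mem_univ _, Y, hY, hv⟩, fun v hv u hu w hw huw => ?_⟩
  obtain ⟨hv1, hv2, hv3⟩ := hBk v hv
  obtain ⟨hw1, hw2, hw3⟩ := hBk w hw
  have hun : IsSmallClosed f S M (Bk v ∪ Bk w) := by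
    have hq := hv1.1.union hw1.1 hu hw2 huw
    have hc := hv1.2.1.union hw1.2.1
    refine ⟨hq, hc, ?_⟩
    by_contra hlt
    have := hgap _ hq hc (not_lt.1 hlt)
    have := Finset.card_union_le (Bk v) (Bk w)
    have := hv1.2.2
    have := hw1.2.2
    omega
  exact (Finset.eq_of_subset_of_card_le Finset.subset_union_right
      (hw3 _ hun (Finset.mem_union_right _ hw2))).trans
    (Finset.eq_of_subset_of_card_le Finset.subset_union_left
      (hv3 _ hun (Finset.mem_union_left _ hv2))).symm

/-- If one side of a cut lies inside the blocks, there is a small connected set that is closed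
for the cut graph. -/
theorem exists_small_closed_of_subset {n : ℕ} {f g : Vtx n → Finset (Vtx n)}
    {S A B W : Finset (Vtx n)} {M : ℕ} {Bk : Vtx n → Finset (Vtx n)}
    (hb : IsBlocks f S M W Bk) (hg : ∀ v, g v ⊆ nbrs v) (hc : IsCut g S A B)
    (hA : A.Nonempty) (hAW : A ⊆ W) : ∃ D, IsSmallClosed g S M D := by
  obtain ⟨a, ha⟩ := hA
  have hY : IsClosedOff g S (A ∩ Bk a) := by
    intro v hv
    rw [Finset.mem_inter] at hv
    refine ⟨hc.avoid_left v hv.1, fun u hu => ?_⟩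
    by_cases huS : u ∈ S
    · exact Finset.mem_union_right _ huS
    have huA : u ∈ A := (hc.cover u huS).resolve_right (hc.left v hv.1 u hu)
    have := hb.eq a (hAW ha) v hv.2 u (hAW huA) (Or.inr (hg v hu))
    exact Finset.mem_union_left _ (Finset.mem_inter.2 ⟨huA, this ▸ hb.mem u (hAW huA)⟩)
  obtain ⟨D, hD, hmin⟩ := Finset.exists_min_image
    ((A ∩ Bk a).powerset.filter fun Y => Y.Nonempty ∧ IsClosedOff g S Y) Finset.card
    ⟨A ∩ Bk a, Finset.mem_filter.2 ⟨Finset.mem_powerset_self _,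
      ⟨a, Finset.mem_inter.2 ⟨ha, hb.mem a (hAW ha)⟩⟩, hY⟩⟩
  rw [Finset.mem_filter, Finset.mem_powerset] at hD
  refine ⟨D, ⟨hD.2.1, fun X hX hne hXD => ?_⟩, hD.2.2, ?_⟩
  · by_contra hcon
    push Not at hcon
    have hXc : IsClosedOff g S X := by
      intro v hv
      refine ⟨(hD.2.2 v (hX hv)).1, fun u hu => ?_⟩
      rcases Finset.mem_union.1 ((hD.2.2 v (hX hv)).2 hu) with h | h
      · refine Finset.mem_union_left _ ?_
        by_contra huX
        obtain ⟨i, rfl⟩ := mem_nbrs.1 (hg v hu)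
        exact hcon v hv i (Finset.mem_sdiff.2 ⟨h, huX⟩)
      · exact Finset.mem_union_right _ h
    have := hmin X (Finset.mem_filter.2 ⟨Finset.mem_powerset.2 (hX.trans hD.1), hne, hXc⟩)
    exact hXD (Finset.eq_of_subset_of_card_le hX this)
  · exact (Finset.card_le_card (hD.1.trans Finset.inter_subset_right)).trans_lt
      (hb.small a (hAW ha)).2.2

/-- The graph of all choices, with the vertices of `S` removed. -/
def offGraph {n : ℕ} (f : Vtx n → Finset (Vtx n)) (S : Finset (Vtx n)) : SimpleGraph (Vtx n) where
  Adj u v := u ≠ v ∧ u ∉ S ∧ v ∉ S ∧ (v ∈ f u ∨ u ∈ f v)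
  symm := ⟨fun _ _ h => ⟨h.1.symm, h.2.2.1, h.2.1, h.2.2.2.symm⟩⟩
  loopless := ⟨fun _ h => h.1 rfl⟩

/-- The component of `v` in `offGraph f S`. -/
def comp {n : ℕ} (f : Vtx n → Finset (Vtx n)) (S : Finset (Vtx n)) (v : Vtx n) :
    Finset (Vtx n) :=
  Finset.univ.filter fun u => (offGraph f S).Reachable v u

section Components

variable {n : ℕ} {f : Vtx n → Finset (Vtx n)} {S : Finset (Vtx n)}

lemma mem_comp {u v : Vtx n} : u ∈ comp f S v ↔ (offGraph f S).Reachable v u := by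
  simp [comp]

lemma mem_comp_self (v : Vtx n) : v ∈ comp f S v := mem_comp.2 (SimpleGraph.Reachable.refl v)

lemma exists_adj_crossing {u v : Vtx n} (h : (offGraph f S).Reachable u v) (X : Finset (Vtx n))
    (hu : u ∈ X) (hv : v ∉ X) : ∃ a ∈ X, ∃ b, b ∉ X ∧ (offGraph f S).Adj a b := by
  obtain ⟨p⟩ := h
  obtain ⟨d, -, h1, h2⟩ := p.exists_boundary_dart (↑X : Set (Vtx n)) (by simpa using hu)
    (by simpa using hv)
  exact ⟨d.fst, by simpa using h1, d.snd, by simpa using h2, d.adj⟩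

lemma mem_nbrs_of_adj (hf : ∀ v, f v ⊆ nbrs v) {u v : Vtx n} (h : (offGraph f S).Adj u v) :
    v ∈ nbrs u := by
  rcases h.2.2.2 with h | h
  · exact hf u h
  · exact mem_nbrs_comm.1 (hf v h)

lemma qconn_comp (hf : ∀ v, f v ⊆ nbrs v) (v : Vtx n) : QConn (comp f S v) := by
  refine ⟨⟨v, mem_comp_self v⟩, fun X hX ⟨x, hx⟩ hXne => ?_⟩
  obtain ⟨y, hy, hyX⟩ := Finset.exists_of_ssubset (lt_of_le_of_ne hX hXne)
  obtain ⟨a, ha, b, hb, hab⟩ :=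
    exists_adj_crossing ((mem_comp.1 (hX hx)).symm.trans (mem_comp.1 hy)) X hx hyX
  obtain ⟨i, rfl⟩ := mem_nbrs.1 (mem_nbrs_of_adj hf hab)
  exact ⟨a, ha, i, Finset.mem_sdiff.2
    ⟨mem_comp.2 ((mem_comp.1 (hX ha)).trans hab.reachable), hb⟩⟩

lemma notMem_of_mem_comp {u v : Vtx n} (hv : v ∉ S) (h : u ∈ comp f S v) : u ∉ S := by
  intro hu
  obtain ⟨a, -, b, hb, hab⟩ := exists_adj_crossing (mem_comp.1 h) Sᶜ
    (Finset.mem_compl.2 hv) (by simpa using hu)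
  exact hab.2.2.1 (by simpa using hb)

lemma isClosedOff_comp (hf : ∀ v, f v ⊆ nbrs v) {v : Vtx n} (hv : v ∉ S) :
    IsClosedOff f S (comp f S v) := by
  intro u hu
  refine ⟨notMem_of_mem_comp hv hu, fun w hw => ?_⟩
  by_cases hwS : w ∈ S
  · exact Finset.mem_union_right _ hwS
  refine Finset.mem_union_left _ (mem_comp.2 ((mem_comp.1 hu).trans (SimpleGraph.Adj.reachable
    ⟨?_, notMem_of_mem_comp hv hu, hwS, Or.inl hw⟩)))
  rintro rfl
  exact not_mem_nbrs_self u (hf u hw)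

lemma IsCut.comp_subset {g : Vtx n → Finset (Vtx n)} {A B : Finset (Vtx n)}
    (hc : IsCut g S A B) (hfg : ∀ v, f v ⊆ g v) {v : Vtx n} (hv : v ∈ A) :
    comp f S v ⊆ A := by
  intro u hu
  by_contra huA
  obtain ⟨a, ha, b, hb, hab⟩ := exists_adj_crossing (mem_comp.1 hu) A hv huA
  have hbB : b ∈ B := (hc.cover b hab.2.2.1).resolve_left hb
  rcases hab.2.2.2 with h | h
  · exact hc.left a ha b (hfg a h) hbB
  · exact hc.right b hbB a (hfg b h) ha

lemma card_comp_inter_le {M : ℕ} {W : Finset (Vtx n)} {Bk : Vtx n → Finset (Vtx n)}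
    (hb : IsBlocks f S M W Bk) (hf : ∀ v, f v ⊆ nbrs v) {A : Finset (Vtx n)}
    (hA : ∀ a ∈ A, ∃ v ∈ A, v ∉ W ∧ a ∈ comp f S v) (hA' : ∀ a ∈ A, comp f S a ⊆ A) :
    A.card ≤ (n * M + 1) * (A \ W).card := by
  have hsub : A ∩ W ⊆ (A \ W).biUnion fun v => (nbrs v ∩ W).biUnion Bk := by
    intro w hw
    rw [Finset.mem_inter] at hw
    obtain ⟨v, hv, hvW, hvw⟩ := hA w hw.1
    have hvB : v ∉ Bk w := fun h => hvW (hb.subset _ (hb.small w hw.2) h)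
    obtain ⟨x, hx, y, hy, hxy⟩ := exists_adj_crossing (mem_comp.1 hvw).symm
      (Bk w ∩ comp f S w) (Finset.mem_inter.2 ⟨hb.mem w hw.2, mem_comp_self w⟩)
      (fun h => hvB (Finset.mem_inter.1 h).1)
    rw [Finset.mem_inter] at hx
    have hyc : y ∈ comp f S w := mem_comp.2 ((mem_comp.1 hx.2).trans hxy.reachable)
    have hyB : y ∉ Bk w := fun h => hy (Finset.mem_inter.2 ⟨h, hyc⟩)
    have hyW : y ∉ W := fun h => by
      have := hb.eq w hw.2 x hx.1 y h (Or.inr (mem_nbrs_of_adj hf hxy))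
      exact hyB (this ▸ hb.mem y h)
    have hxW : x ∈ W := hb.subset _ (hb.small w hw.2) hx.1
    refine Finset.mem_biUnion.2 ⟨y, Finset.mem_sdiff.2 ⟨hA' w hw.1 hyc, hyW⟩,
      Finset.mem_biUnion.2 ⟨x, Finset.mem_inter.2
        ⟨mem_nbrs_comm.1 (mem_nbrs_of_adj hf hxy), hxW⟩, ?_⟩⟩
    rw [hb.eq w hw.2 x hx.1 x hxW (Or.inl rfl)]
    exact hb.mem w hw.2
  have h1 : (A ∩ W).card ≤ (A \ W).card * (n * M) := by
    refine (Finset.card_le_card hsub).trans (Finset.card_biUnion_le_card_mul _ _ _ fun v _ => ?_)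
    refine (Finset.card_biUnion_le_card_mul _ _ M fun x hx => ?_).trans
      (Nat.mul_le_mul_right _ ((Finset.card_le_card Finset.inter_subset_left).trans
        (card_nbrs v).le))
    exact (hb.small x (Finset.mem_inter.1 hx).2).2.2.le
  have h2 := Finset.card_inter_add_card_sdiff A W
  calc A.card = (A ∩ W).card + (A \ W).card := h2.symm
    _ ≤ (A \ W).card * (n * M) + (A \ W).card := by omega
    _ = _ := by ring

theorem IsCut.exists_representatives {M L : ℕ} {W : Finset (Vtx n)} {Bk : Vtx n → Finset (Vtx n)}
    (hb : IsBlocks f S M W Bk) (hf : ∀ v, f v ⊆ nbrs v)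
    (hgap : ∀ D, QConn D → IsClosedOff f S D → M ≤ D.card → L < D.card)
    {g : Vtx n → Finset (Vtx n)} {A B : Finset (Vtx n)} (hc : IsCut g S A B)
    (hfg : ∀ v, f v ⊆ g v) (hA : (A \ W).Nonempty) :
    ∃ R : Finset (Vtx n), R.Nonempty ∧ A \ W = R.biUnion (comp f S) \ W ∧
      R.card * L ≤ (n * M + 1) * (A \ W).card := by
  set rep : Vtx n → Vtx n := fun v => ((offGraph f S).connectedComponentMk v).out with hrep
  have hrv : ∀ v, comp f S (rep v) = comp f S v := fun v => by
    have : (offGraph f S).Reachable (rep v) v :=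
      SimpleGraph.ConnectedComponent.exact (Quot.out_eq _)
    ext u
    rw [mem_comp, mem_comp]
    exact ⟨fun h => this.symm.trans h, fun h => this.trans h⟩
  set R := (A \ W).image rep with hR
  set A' := R.biUnion (comp f S) with hA'
  have hA'A : A' ⊆ A := by
    intro u hu
    obtain ⟨r, hr, hur⟩ := Finset.mem_biUnion.1 hu
    obtain ⟨v, hv, rfl⟩ := Finset.mem_image.1 hr
    rw [hrv] at hur
    exact hc.comp_subset hfg (Finset.mem_sdiff.1 hv).1 hur
  have hsub : A \ W ⊆ A' := fun v hv => Finset.mem_biUnion.2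
    ⟨rep v, Finset.mem_image_of_mem _ hv, by rw [hrv]; exact mem_comp_self v⟩
  have heq : A \ W = A' \ W := by
    ext v
    simp only [Finset.mem_sdiff]
    exact ⟨fun h => ⟨hsub (Finset.mem_sdiff.2 h), h.2⟩, fun h => ⟨hA'A h.1, h.2⟩⟩
  refine ⟨R, hA.image _, heq, ?_⟩
  have h1 : R.card * L ≤ A'.card := by
    rw [hA', Finset.card_biUnion]
    · rw [← smul_eq_mul]
      refine Finset.card_nsmul_le_sum _ _ _ fun r hr => ?_
      obtain ⟨v, hv, rfl⟩ := Finset.mem_image.1 hr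
      rw [hrv]
      rw [Finset.mem_sdiff] at hv
      have hvS := hc.avoid_left v hv.1
      refine (hgap _ (qconn_comp hf v) (isClosedOff_comp hf hvS) ?_).le
      by_contra hlt
      exact hv.2 (hb.subset _ ⟨qconn_comp hf v, isClosedOff_comp hf hvS, not_le.1 hlt⟩
        (mem_comp_self v))
    · intro r hr s hs hrs
      refine Finset.disjoint_left.2 fun u hu hu' => hrs ?_
      obtain ⟨v, -, rfl⟩ := Finset.mem_image.1 hr
      obtain ⟨w, -, rfl⟩ := Finset.mem_image.1 hs
      rw [hrv, mem_comp] at hu hu'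
      have := SimpleGraph.ConnectedComponent.sound (hu.trans hu'.symm)
      simp only [hrep, this]
  refine h1.trans ?_
  rw [heq]
  refine card_comp_inter_le hb hf (fun a ha => ?_) fun a ha => ?_
  · obtain ⟨r, hr, har⟩ := Finset.mem_biUnion.1 ha
    obtain ⟨v, hv, rfl⟩ := Finset.mem_image.1 hr
    rw [hrv] at har
    exact ⟨v, hsub hv, (Finset.mem_sdiff.1 hv).2, har⟩
  · obtain ⟨r, hr, har⟩ := Finset.mem_biUnion.1 ha
    intro u hu
    exact Finset.mem_biUnion.2 ⟨r, hr, mem_comp.2 ((mem_comp.1 har).trans (mem_comp.1 hu))⟩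

end Components

/-! ### Linking units -/

/-- A connected set carries a map towards a neighbour `b` of one of its vertices. -/
lemma QConn.exists_parent {n : ℕ} {D : Finset (Vtx n)} (hD : QConn D) {r b : Vtx n} (hr : r ∈ D)
    (hb : b ∈ nbrs r) : ∃ p : Vtx n → Vtx n, (∀ v ∈ D, p v ∈ nbrs v) ∧
      ∀ Q : Finset (Vtx n), b ∈ Q → (∀ v ∈ D, p v ∈ Q → v ∈ Q) → D ⊆ Q := by
  refine hD.growth hr (fun Z => ∃ p : Vtx n → Vtx n, (∀ v ∈ Z, p v ∈ nbrs v) ∧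
      ∀ Q : Finset (Vtx n), b ∈ Q → (∀ v ∈ Z, p v ∈ Q → v ∈ Q) → Z ⊆ Q) ?_ ?_
  · refine ⟨fun _ => b, fun v hv => ?_, fun Q hQ h => ?_⟩
    · rwa [Finset.mem_singleton.1 hv]
    · rw [Finset.singleton_subset_iff]
      exact h r (Finset.mem_singleton_self r) hQ
  · rintro Z - - ⟨p, hp1, hp2⟩ z hz i hi
    have hne : ∀ v ∈ Z, v ≠ flipAt z i := fun v hv h => (Finset.mem_sdiff.1 hi).2 (h ▸ hv)
    refine ⟨fun v => if v = flipAt z i then z else p v, fun v hv => ?_, fun Q hQ h => ?_⟩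
    · rcases Finset.mem_insert.1 hv with rfl | hv
      · beta_reduce
        rw [if_pos rfl]
        exact mem_nbrs_comm.1 (flipAt_mem_nbrs z i)
      · beta_reduce
        rw [if_neg (hne v hv)]
        exact hp1 v hv
    · have hZ : Z ⊆ Q := hp2 Q hQ fun v hv hpv => by
        refine h v (Finset.mem_insert_of_mem hv) ?_
        beta_reduce
        rwa [if_neg (hne v hv)]
      refine Finset.insert_subset (h _ (Finset.mem_insert_self _ _) ?_) hZ
      beta_reduce
      rw [if_pos rfl]
      exact hZ hz

/-- Choosing all the edges in `need` on `U` joins `A₀` to `B₀`. -/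
def IsLinking {n : ℕ} (S A₀ B₀ U : Finset (Vtx n)) (need : Vtx n → Finset (Vtx n)) : Prop :=
  (∀ v, need v ⊆ nbrs v) ∧ (∀ v, (need v).card ≤ 2) ∧
    ∀ g A B, IsCut g S A B → A₀ ⊆ A → B₀ ⊆ B → ∃ v ∈ U, ¬ need v ⊆ g v

lemma isLinking_singleton {n : ℕ} {S A₀ B₀ : Finset (Vtx n)} {a b : Vtx n} (ha : a ∈ A₀)
    (hb : b ∈ B₀) (hab : b ∈ nbrs a) : IsLinking S A₀ B₀ {a} fun v => {b} ∩ nbrs v := by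
  refine ⟨fun v => Finset.inter_subset_right, fun v =>
    (Finset.card_le_card Finset.inter_subset_left).trans (by simp), fun g A B hc hA hB => ?_⟩
  refine ⟨a, Finset.mem_singleton_self a, fun h => hc.left a (hA ha) b (h ?_) (hB hb)⟩
  exact Finset.mem_inter.2 ⟨Finset.mem_singleton_self b, hab⟩

lemma QConn.exists_isLinking {n : ℕ} {S A₀ B₀ D : Finset (Vtx n)} (hD : QConn D)
    (hDS : ∀ v ∈ D, v ∉ S) {x z a b : Vtx n} (hx : x ∈ D) (hz : z ∈ D) (ha : a ∈ A₀)
    (hb : b ∈ B₀) (hxb : b ∈ nbrs x) (hza : a ∈ nbrs z) :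
    ∃ need, IsLinking S A₀ B₀ D need := by
  obtain ⟨p, hp, hQ⟩ := hD.exists_parent hx hxb
  refine ⟨fun v => {if v = z then a else p v, p v} ∩ nbrs v,
    fun v => Finset.inter_subset_right, fun v =>
    (Finset.card_le_card Finset.inter_subset_left).trans Finset.card_le_two,
    fun g A B hc hA hB => ?_⟩
  by_contra hcon
  push Not at hcon
  have hDB : D ⊆ B := hQ B (hB hb) fun v hv hpv => by
    refine (hc.cover v (hDS v hv)).resolve_left fun hvA => hc.left v hvA (p v) ?_ hpv
    exact hcon v hv (Finset.mem_inter.2 ⟨by simp, hp v hv⟩)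
  refine hc.right z (hDB hz) a ?_ (hA ha)
  exact hcon z hz (Finset.mem_inter.2 ⟨by simp, hza⟩)

theorem IsBlocks.exists_linking_family {n M : ℕ} {f : Vtx n → Finset (Vtx n)}
    {S W A₀ B₀ : Finset (Vtx n)} {Bk : Vtx n → Finset (Vtx n)} (hb : IsBlocks f S M W Bk)
    (hM : 1 ≤ M)
    (hAW : Disjoint A₀ W) (hBW : Disjoint B₀ W) (hAB : Disjoint A₀ B₀)
    (hcover : ∀ v, v ∉ S → v ∉ W → v ∈ A₀ ∨ v ∈ B₀) (hle : A₀.card ≤ B₀.card)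
    (hS : 2 * (n * S.card) ≤ A₀.card) :
    ∃ (𝒰 : Finset (Finset (Vtx n))) (need : Finset (Vtx n) → Vtx n → Finset (Vtx n)),
      (𝒰 : Set (Finset (Vtx n))).PairwiseDisjoint id ∧ (∀ U ∈ 𝒰, U.card ≤ M) ∧
      (∀ U ∈ 𝒰, IsLinking S A₀ B₀ U (need U)) ∧ A₀.card ≤ 2 * n * M * 𝒰.card := by
  set X : Finset (Vtx n) := A₀ ∪ W.filter fun v => ∃ z ∈ Bk v, ∃ a ∈ A₀, a ∈ nbrs z with hX
  have hXB : ∀ v ∈ X, v ∉ B₀ := by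
    intro v hv
    rcases Finset.mem_union.1 hv with h | h
    · exact Finset.disjoint_left.1 hAB h
    · exact Finset.disjoint_right.1 hBW (Finset.mem_filter.1 h).1
  have hbd : ∀ x ∈ X, nbrs x \ X ⊆ (nbrs x ∩ B₀) ∪ (nbrs x ∩ S) := by
    intro x hx y hy
    rw [Finset.mem_sdiff] at hy
    rw [Finset.mem_union, Finset.mem_inter, Finset.mem_inter]
    by_contra hcon
    have hyB : y ∉ B₀ := fun h => hcon (Or.inl ⟨hy.1, h⟩)
    have hyS : y ∉ S := fun h => hcon (Or.inr ⟨hy.1, h⟩)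
    have hyA : y ∉ A₀ := fun h => hy.2 (Finset.mem_union_left _ h)
    have hyW : y ∈ W := by
      by_contra h
      exact (hcover y hyS h).elim hyA hyB
    refine hy.2 (Finset.mem_union_right _ (Finset.mem_filter.2 ⟨hyW, ?_⟩))
    rcases Finset.mem_union.1 hx with h | h
    · exact ⟨y, hb.mem y hyW, x, h, mem_nbrs_comm.1 hy.1⟩
    · obtain ⟨hxW, hx2⟩ := Finset.mem_filter.1 h
      rwa [hb.eq x hxW x (hb.mem x hxW) y hyW (Or.inr hy.1)]
  set X₀ := X.filter fun x => ∃ b ∈ B₀, b ∈ nbrs x with hX₀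
  have hcount : A₀.card ≤ 2 * n * X₀.card := by
    have h1 : A₀.card ≤ ∑ x ∈ X, (nbrs x \ X).card := by
      refine le_trans (le_min (Finset.card_le_card Finset.subset_union_left)
        (hle.trans (Finset.card_le_card fun v hv => ?_))) (min_card_le_sum_nbrs_sdiff X)
      exact Finset.mem_compl.2 fun h => hXB v h hv
    have h2 : ∑ x ∈ X, (nbrs x \ X).card ≤
        ∑ x ∈ X, (nbrs x ∩ B₀).card + ∑ x ∈ X, (nbrs x ∩ S).card := by
      rw [← Finset.sum_add_distrib]
      exact Finset.sum_le_sum fun x hx =>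
        (Finset.card_le_card (hbd x hx)).trans (Finset.card_union_le _ _)
    have hn : ∀ (v : Vtx n) (Z : Finset (Vtx n)), (nbrs v ∩ Z).card ≤ n := fun v Z =>
      (Finset.card_le_card Finset.inter_subset_left).trans (card_nbrs v).le
    have h3 : ∑ x ∈ X, (nbrs x ∩ S).card ≤ n * S.card := by
      rw [sum_nbrs_inter_comm, mul_comm]
      exact Finset.sum_le_card_nsmul _ _ _ fun v _ => hn v X
    have h4 : ∑ x ∈ X, (nbrs x ∩ B₀).card ≤ n * X₀.card := by
      have : ∑ x ∈ X, (nbrs x ∩ B₀).card = ∑ x ∈ X₀, (nbrs x ∩ B₀).card := by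
        rw [hX₀, Finset.sum_filter_of_ne]
        intro x _ hne
        obtain ⟨b, hb'⟩ := Finset.card_pos.1 (Nat.pos_of_ne_zero hne)
        rw [Finset.mem_inter] at hb'
        exact ⟨b, hb'.2, hb'.1⟩
      rw [this, mul_comm]
      exact Finset.sum_le_card_nsmul _ _ _ fun v _ => hn v B₀
    have : 2 * n * X₀.card = 2 * (n * X₀.card) := by ring
    omega
  set un : Vtx n → Finset (Vtx n) := fun x => if x ∈ W then Bk x else {x} with hun
  have hmem : ∀ x, x ∈ un x := fun x => by
    by_cases h : x ∈ W
    · simp only [hun, h, if_true]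
      exact hb.mem x h
    · simp [hun, h]
  have hcard : ∀ x, (un x).card ≤ M := fun x => by
    by_cases h : x ∈ W
    · simp only [hun, h, if_true]
      exact (hb.small x h).2.2.le
    · simpa [hun, h] using hM
  have hlink : ∀ U, ∃ need, U ∈ X₀.image un → IsLinking S A₀ B₀ U need := by
    intro U
    by_cases hU : U ∈ X₀.image un
    · obtain ⟨x, hx, rfl⟩ := Finset.mem_image.1 hU
      obtain ⟨hxX, b, hbB, hxb⟩ := Finset.mem_filter.1 hx
      rcases Finset.mem_union.1 hxX with h | h
      · have hW : x ∉ W := Finset.disjoint_left.1 hAW h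
        simp only [hun, hW, if_false]
        exact ⟨_, fun _ => isLinking_singleton h hbB hxb⟩
      · obtain ⟨hxW, z, hz, a, ha, hza⟩ := Finset.mem_filter.1 h
        simp only [hun, hxW, if_true]
        obtain ⟨need, hneed⟩ := (hb.small x hxW).1.exists_isLinking
          (fun v hv => ((hb.small x hxW).2.1 v hv).1) (hb.mem x hxW) hz ha hbB hxb hza
        exact ⟨need, fun _ => hneed⟩
    · exact ⟨fun _ => ∅, fun h => absurd h hU⟩
  choose need hneed using hlink
  refine ⟨X₀.image un, need, ?_, ?_, hneed, ?_⟩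
  · intro U hU V hV hne
    obtain ⟨x, -, rfl⟩ := Finset.mem_image.1 hU
    obtain ⟨y, -, rfl⟩ := Finset.mem_image.1 hV
    refine Finset.disjoint_left.2 fun u hu hu' => hne ?_
    have key : ∀ x, u ∈ un x → un u = un x := fun x hu => by
      by_cases h : x ∈ W
      · simp only [hun, h, if_true] at hu
        have huW : u ∈ W := hb.subset _ (hb.small x h) hu
        simp only [hun, h, huW, if_true]
        exact hb.eq x h u hu u huW (Or.inl rfl)
      · simp only [hun, h, if_false, Finset.mem_singleton] at hu
        rw [hu]
    rw [← key x hu, ← key y hu']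
  · intro U hU
    obtain ⟨x, -, rfl⟩ := Finset.mem_image.1 hU
    exact hcard x
  · have h5 : X₀.card ≤ M * (X₀.image un).card := by
      refine Finset.card_le_mul_card_image _ _ fun U hU => ?_
      obtain ⟨x, -, rfl⟩ := Finset.mem_image.1 hU
      refine (Finset.card_le_card fun y hy => ?_).trans (hcard x)
      rw [← (Finset.mem_filter.1 hy).2]
      exact hmem y
    calc A₀.card ≤ 2 * n * X₀.card := hcount
      _ ≤ 2 * n * (M * (X₀.image un).card) := Nat.mul_le_mul_left _ h5
      _ = _ := by ring

/-! ### Counting extensions of a choice -/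

lemma card_filter_forall_exists_ne_le {ι : Type*} [Fintype ι] [DecidableEq ι] {α : ι → Type*}
    [∀ i, DecidableEq (α i)] (F : ∀ i, Finset (α i)) (c M : ℕ) (hc : 1 ≤ c)
    (hF : ∀ i, (F i).card ≤ c) (𝒰 : Finset (Finset ι))
    (hdisj : (𝒰 : Set (Finset ι)).PairwiseDisjoint id) (hM : ∀ U ∈ 𝒰, U.card ≤ M)
    (τ : Finset ι → ∀ i, α i) (hτ : ∀ U ∈ 𝒰, ∀ i, τ U i ∈ F i) :
    (((Fintype.piFinset F).filter fun ω => ∀ U ∈ 𝒰, ∃ i ∈ U, ω i ≠ τ U i).card : ℝ) ≤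
      (1 - 1 / (c : ℝ) ^ M) ^ 𝒰.card * (Fintype.piFinset F).card := by
  have hcM : (0 : ℝ) < (c : ℝ) ^ M := by
    have : (0 : ℝ) < c := by exact_mod_cast hc
    positivity
  have hc1 : (0 : ℝ) ≤ 1 - 1 / (c : ℝ) ^ M := by
    rw [sub_nonneg, div_le_one hcM]
    exact one_le_pow₀ (by exact_mod_cast hc)
  induction 𝒰 using Finset.induction_on with
  | empty => simp
  | insert U 𝒱 hU ih =>
    have ih' := ih (hdisj.subset (by simp)) (fun V hV => hM V (Finset.mem_insert_of_mem hV))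
      fun V hV => hτ V (Finset.mem_insert_of_mem hV)
    set G := (Fintype.piFinset F).filter fun ω => ∀ V ∈ 𝒱, ∃ i ∈ V, ω i ≠ τ V i with hG
    set H := G.filter fun ω => ∀ i ∈ U, ω i = τ U i with hH
    have hUτ := hτ U (Finset.mem_insert_self _ _)
    have hsplit : ((Fintype.piFinset F).filter fun ω => ∀ V ∈ insert U 𝒱, ∃ i ∈ V,
        ω i ≠ τ V i) = G \ H := by
      ext ω
      simp only [hG, hH, Finset.mem_filter, Finset.mem_sdiff, Finset.forall_mem_insert]
      constructor
      · rintro ⟨h1, ⟨i, hi, hne⟩, h2⟩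
        exact ⟨⟨h1, h2⟩, fun h => hne (h.2 i hi)⟩
      · rintro ⟨⟨h1, h2⟩, h3⟩
        refine ⟨h1, ?_, h2⟩
        by_contra hcon
        push Not at hcon
        exact h3 ⟨⟨h1, h2⟩, hcon⟩
    have hGH : G.card ≤ H.card * c ^ M := by
      have h1 : G.card ≤ (H ×ˢ U.pi F).card := by
        refine Finset.card_le_card_of_injOn
          (fun ω => (fun i => if i ∈ U then τ U i else ω i, fun i _ => ω i)) ?_ ?_
        · intro ω hω
          obtain ⟨hω1, hω2⟩ := Finset.mem_filter.1 hω
          rw [Fintype.mem_piFinset] at hω1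
          refine Finset.mem_coe.2 (Finset.mem_product.2 ⟨Finset.mem_filter.2
            ⟨Finset.mem_filter.2 ⟨?_, ?_⟩, ?_⟩, ?_⟩)
          · rw [Fintype.mem_piFinset]
            intro i
            by_cases hi : i ∈ U
            · simpa [hi] using hUτ i
            · simpa [hi] using hω1 i
          · intro V hV
            obtain ⟨i, hi, hne⟩ := hω2 V hV
            refine ⟨i, hi, ?_⟩
            have hVU : V ≠ U := fun h => hU (h ▸ hV)
            have : i ∉ U := Finset.disjoint_left.1
              (hdisj (by simp [hV]) (by simp) hVU) hi
            simpa [this] using hne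
          · intro i hi
            simp [hi]
          · rw [Finset.mem_pi]
            exact fun i _ => hω1 i
        · intro ω _ η _ h
          funext i
          rw [Prod.mk.injEq] at h
          by_cases hi : i ∈ U
          · exact congrFun (congrFun h.2 i) hi
          · simpa [hi] using congrFun h.1 i
      refine h1.trans ?_
      rw [Finset.card_product, Finset.card_pi]
      refine Nat.mul_le_mul_left _ ((Finset.prod_le_pow_card _ _ c fun i _ => hF i).trans ?_)
      exact Nat.pow_le_pow_right hc (hM U (Finset.mem_insert_self _ _))
    have hGH' : (G.card : ℝ) ≤ H.card * (c : ℝ) ^ M := by exact_mod_cast hGH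
    have hGH2 : (G.card : ℝ) / (c : ℝ) ^ M ≤ H.card := by rwa [div_le_iff₀ hcM]
    rw [hsplit, Finset.card_sdiff_of_subset (Finset.filter_subset _ _),
      Nat.cast_sub (Finset.card_le_card (Finset.filter_subset _ _)),
      Finset.card_insert_of_notMem hU, pow_succ]
    calc (G.card : ℝ) - H.card ≤ G.card - (G.card : ℝ) / (c : ℝ) ^ M := by linarith
      _ = (1 - 1 / (c : ℝ) ^ M) * G.card := by ring
      _ ≤ (1 - 1 / (c : ℝ) ^ M) * ((1 - 1 / (c : ℝ) ^ M) ^ 𝒱.card *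
          (Fintype.piFinset F).card) := mul_le_mul_of_nonneg_left ih' hc1
      _ = _ := by ring

/-- The extensions of a `j`-element choice to a `k`-element choice. -/
def extensions {n j : ℕ} (k : ℕ) {v : Vtx n} (t : Choice j v) : Finset (Choice k v) :=
  Finset.univ.filter fun s => t.1 ⊆ s.1

lemma card_extensions_le {n j k : ℕ} {v : Vtx n} (t : Choice j v) :
    (extensions k t).card ≤ (n - j).choose (k - j) := by
  have h : (nbrs v \ t.1).card = n - j := by
    rw [Finset.card_sdiff_of_subset (choice_subset_nbrs t), card_nbrs, t.2.1]
  rw [← h, ← Finset.card_powersetCard]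
  refine Finset.card_le_card_of_injOn (fun s => s.1 \ t.1) ?_ ?_
  · intro s hs
    have hs' := (Finset.mem_filter.1 hs).2
    refine Finset.mem_coe.2 (Finset.mem_powersetCard.2
      ⟨Finset.sdiff_subset_sdiff (choice_subset_nbrs s) le_rfl, ?_⟩)
    rw [Finset.card_sdiff_of_subset hs', s.2.1, t.2.1]
  · intro s hs r hr h
    have hs' := (Finset.mem_filter.1 hs).2
    have hr' := (Finset.mem_filter.1 hr).2
    apply Subtype.ext
    rw [← Finset.sdiff_union_of_subset hs', ← Finset.sdiff_union_of_subset hr']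
    exact congrArg (· ∪ t.1) h

lemma card_kOut (n k : ℕ) : Fintype.card (KOut n k) = n.choose k ^ 2 ^ n := by
  rw [Fintype.card_pi, Finset.prod_congr rfl fun v _ => card_choice k v]
  simp

/-- Comparison of the `k`-out model with the `j`-out model: an event that is unlikely given any
good `j`-out choice is unlikely. -/
theorem prob_le_prob_add_of_extensions {n j k : ℕ} (hjk : j ≤ k) (hkn : k ≤ n)
    (bad : KOut n k → Prop) [DecidablePred bad] (exc : KOut n j → Prop) (ε : ℝ) (hε : 0 ≤ ε)
    (h : ∀ η : KOut n j, ¬ exc η →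
      (((Fintype.piFinset fun v => extensions k (η v)).filter bad).card : ℝ) ≤
        ε * ((n - j).choose (k - j) : ℝ) ^ 2 ^ n) :
    prob bad ≤ prob exc + ε := by
  have hdc := Finset.sum_card_bipartiteAbove_eq_sum_card_bipartiteBelow
    (s := Finset.univ.filter bad) (t := (Finset.univ : Finset (KOut n j)))
    (fun (ω : KOut n k) (η : KOut n j) => ∀ v, (η v).1 ⊆ (ω v).1)
  have hab : ∀ ω : KOut n k, (Finset.bipartiteAbove
      (fun (ω : KOut n k) (η : KOut n j) => ∀ v, (η v).1 ⊆ (ω v).1) Finset.univ ω).card =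
      k.choose j ^ 2 ^ n := by
    intro ω
    have : Finset.bipartiteAbove (fun (ω : KOut n k) (η : KOut n j) => ∀ v, (η v).1 ⊆ (ω v).1)
        Finset.univ ω = Fintype.piFinset fun v =>
          Finset.univ.filter fun s : Choice j v => s.1 ⊆ (ω v).1 := by
      ext η
      simp [Finset.bipartiteAbove, Fintype.mem_piFinset]
    rw [this, Fintype.card_piFinset, Finset.prod_congr rfl fun v _ => by
      rw [card_choice_subset, Finset.inter_eq_right.2 (choice_subset_nbrs (ω v)), (ω v).2.1]]
    simp
  have hbe : ∀ η : KOut n j, Finset.bipartiteBelow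
      (fun (ω : KOut n k) (η : KOut n j) => ∀ v, (η v).1 ⊆ (ω v).1)
      (Finset.univ.filter bad) η =
      (Fintype.piFinset fun v => extensions k (η v)).filter bad := by
    intro η
    ext ω
    simp [Finset.bipartiteBelow, Fintype.mem_piFinset, extensions, and_comm]
  set c : ℝ := ((n - j).choose (k - j) : ℝ) ^ 2 ^ n with hc
  have hc0 : 0 ≤ c := by positivity
  have hall : ∀ η : KOut n j,
      (((Fintype.piFinset fun v => extensions k (η v)).filter bad).card : ℝ) ≤ c := by
    intro η
    have h1 : ((Fintype.piFinset fun v => extensions k (η v)).filter bad).card ≤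
        ((n - j).choose (k - j)) ^ 2 ^ n := by
      refine (Finset.card_le_card (Finset.filter_subset _ _)).trans ?_
      rw [Fintype.card_piFinset]
      refine (Finset.prod_le_pow_card _ _ _ fun v _ => card_extensions_le (η v)).trans ?_
      simp
    rw [hc]
    exact_mod_cast h1
  have hsum : ((Finset.univ.filter bad).card : ℝ) * (k.choose j : ℝ) ^ 2 ^ n ≤
      ((Finset.univ.filter exc).card + Fintype.card (KOut n j) * ε) * c := by
    have e1 : ((Finset.univ.filter bad).card : ℝ) * (k.choose j : ℝ) ^ 2 ^ n =
        ∑ η : KOut n j, (((Fintype.piFinset fun v => extensions k (η v)).filter bad).card : ℝ) := by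
      rw [Finset.sum_congr rfl fun ω _ => hab ω, Finset.sum_const, smul_eq_mul,
        Finset.sum_congr rfl fun η _ => by rw [hbe η]] at hdc
      exact_mod_cast hdc
    rw [e1, ← Finset.sum_filter_add_sum_filter_not Finset.univ exc, add_mul]
    refine add_le_add ?_ ?_
    · rw [← nsmul_eq_mul]
      exact Finset.sum_le_card_nsmul _ _ _ fun η _ => hall η
    · refine (Finset.sum_le_card_nsmul _ _ (ε * c) fun η hη =>
        h η (Finset.mem_filter.1 hη).2).trans ?_
      rw [nsmul_eq_mul, mul_assoc]
      refine mul_le_mul_of_nonneg_right ?_ (by positivity)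
      exact_mod_cast Finset.card_le_univ _
  have hcard : (Fintype.card (KOut n k) : ℝ) * (k.choose j : ℝ) ^ 2 ^ n =
      Fintype.card (KOut n j) * c := by
    rw [card_kOut, card_kOut, hc]
    push_cast
    rw [← mul_pow, ← mul_pow]
    congr 1
    exact_mod_cast Nat.choose_mul hjk
  have hj0 : (0 : ℝ) < Fintype.card (KOut n j) := by
    rw [card_kOut]
    have := Nat.choose_pos (hjk.trans hkn)
    exact_mod_cast pow_pos this _
  have hk0 : (0 : ℝ) < Fintype.card (KOut n k) := by
    rw [card_kOut]
    have := Nat.choose_pos hkn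
    exact_mod_cast pow_pos this _
  have hb0 : (0 : ℝ) < (k.choose j : ℝ) ^ 2 ^ n := by
    have := Nat.choose_pos hjk
    exact_mod_cast pow_pos this _
  simp only [prob_eq]
  rw [div_add' _ _ _ hj0.ne', div_le_div_iff₀ hk0 hj0]
  have h1 : ((Finset.univ.filter bad).card * Fintype.card (KOut n j) : ℝ) *
      (k.choose j : ℝ) ^ 2 ^ n ≤ (((Finset.univ.filter exc).card + ε * Fintype.card (KOut n j)) *
      Fintype.card (KOut n k)) * (k.choose j : ℝ) ^ 2 ^ n := by
    rw [mul_assoc (_ + _), hcard]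
    nlinarith [mul_le_mul_of_nonneg_right hsum hj0.le]
  exact le_of_mul_le_mul_right h1 hb0

/-! ### Few extensions leave a cut -/

/-- The set of neighbours chosen by a vertex. -/
abbrev chosen {n k : ℕ} (ω : KOut n k) (v : Vtx n) : Finset (Vtx n) := (ω v).1

lemma exists_extension {n j k : ℕ} (hjk : j + 2 ≤ k) (hkn : k ≤ n) {v : Vtx n} (t : Choice j v)
    (s : Finset (Vtx n)) (hs : s ⊆ nbrs v) (hs2 : s.card ≤ 2) :
    ∃ u ∈ extensions k t, s ⊆ u.1 := by
  obtain ⟨u, h1, h2, h3⟩ := Finset.exists_subsuperset_card_eq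
    (Finset.union_subset (choice_subset_nbrs t) hs) (n := k)
    ((Finset.card_union_le _ _).trans (by rw [t.2.1]; omega)) (by rwa [card_nbrs])
  exact ⟨⟨u, h3, fun w hw => adj_iff_mem_nbrs.2 (h2 hw)⟩,
    Finset.mem_filter.2 ⟨Finset.mem_univ _, Finset.subset_union_left.trans h1⟩,
    Finset.subset_union_right.trans h1⟩

/-- The probability that the extension misses every one of `t` linking units. -/
def missProb (c M t : ℕ) : ℝ := (1 - 1 / (c : ℝ) ^ M) ^ t

lemma one_sub_nonneg_of_one_le {c : ℕ} (hc : 1 ≤ c) (M : ℕ) : 0 ≤ 1 - 1 / (c : ℝ) ^ M := by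
  have h1 : (1 : ℝ) ≤ (c : ℝ) ^ M := one_le_pow₀ (by exact_mod_cast hc)
  rw [sub_nonneg, div_le_one (by linarith)]
  exact h1

section Extensions

variable {n j k M : ℕ}

lemma card_extensions_le_pow (η : KOut n j) :
    ((Fintype.piFinset fun v => extensions k (η v)).card : ℝ) ≤
      ((n - j).choose (k - j) : ℝ) ^ 2 ^ n := by
  rw [Fintype.card_piFinset]
  have : ∏ v, (extensions k (η v)).card ≤ ((n - j).choose (k - j)) ^ 2 ^ n := by
    refine (Finset.prod_le_pow_card _ _ _ fun v _ => card_extensions_le (η v)).trans ?_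
    simp
  exact_mod_cast this

lemma card_extensions_cut_eq_le {L t : ℕ} (hjk : j + 2 ≤ k) (hkn : k ≤ n) (hM : 1 ≤ M)
    (ht : t * ((n * M + 1) * (2 * n * M)) ≤ L) (hkt : k ≤ t) (η : KOut n j)
    {S W A₀ R : Finset (Vtx n)} {Bk : Vtx n → Finset (Vtx n)} (hS : S.card < k)
    (hb : IsBlocks (chosen η) S M W Bk) (hR : R.Nonempty)
    (hRL : R.card * L ≤ (n * M + 1) * A₀.card) :
    (((Fintype.piFinset fun v => extensions k (η v)).filter fun ω =>
      ∃ A B, IsCut (chosen ω) S A B ∧ (A \ W).card ≤ (B \ W).card ∧ A \ W = A₀).card : ℝ) ≤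
      missProb ((n - j).choose (k - j)) M t ^ R.card *
        ((n - j).choose (k - j) : ℝ) ^ 2 ^ n := by
  have hc : 1 ≤ (n - j).choose (k - j) := Nat.choose_pos (by omega)
  have h1c := one_sub_nonneg_of_one_le hc M
  by_cases hA : ∃ ω : KOut n k, ∃ A B, IsCut (chosen ω) S A B ∧ (A \ W).card ≤ (B \ W).card ∧
      A \ W = A₀
  swap
  · rw [Finset.filter_false_of_mem fun ω _ h => hA ⟨ω, h⟩]
    simp only [Finset.card_empty, Nat.cast_zero]
    unfold missProb
    positivity
  obtain ⟨_, A, B, hAB, hle, rfl⟩ := hA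
  have hn : 1 ≤ n := by omega
  have hR1 : 1 ≤ R.card := hR.card_pos
  have hRt : R.card * t * (2 * n * M) ≤ (A \ W).card := by
    have : (n * M + 1) * (R.card * t * (2 * n * M)) ≤ (n * M + 1) * (A \ W).card := by
      calc (n * M + 1) * (R.card * t * (2 * n * M))
          = R.card * (t * ((n * M + 1) * (2 * n * M))) := by ring
        _ ≤ R.card * L := Nat.mul_le_mul_left _ ht
        _ ≤ _ := hRL
    exact Nat.le_of_mul_le_mul_left this (Nat.succ_pos _)
  have hBeq : ∀ A' B' : Finset (Vtx n), ∀ g, IsCut g S A' B' → A' \ W = A \ W →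
      B \ W ⊆ B' := by
    intro A' B' g hc' he v hv
    rw [Finset.mem_sdiff] at hv
    refine (hc'.cover v (hAB.avoid_right v hv.1)).resolve_left fun hvA => ?_
    have : v ∈ A \ W := he ▸ Finset.mem_sdiff.2 ⟨hvA, hv.2⟩
    exact hAB.disj v (Finset.mem_sdiff.1 this).1 hv.1
  obtain ⟨𝒰, need, hdisj, hUM, hlink, hcard⟩ := hb.exists_linking_family hM
    (A₀ := A \ W) (B₀ := B \ W) Finset.sdiff_disjoint Finset.sdiff_disjoint
    (Finset.disjoint_left.2 fun v hv hv' =>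
      hAB.disj v (Finset.mem_sdiff.1 hv).1 (Finset.mem_sdiff.1 hv').1)
    (fun v hvS hvW => (hAB.cover v hvS).imp (fun h => Finset.mem_sdiff.2 ⟨h, hvW⟩)
      fun h => Finset.mem_sdiff.2 ⟨h, hvW⟩) hle (by
      refine le_trans ?_ hRt
      calc 2 * (n * S.card) ≤ 2 * (n * (1 * t * M)) := by
            refine Nat.mul_le_mul_left _ (Nat.mul_le_mul_left _ ?_)
            nlinarith
        _ = 1 * t * (2 * n * M) := by ring
        _ ≤ _ := Nat.mul_le_mul_right _ (Nat.mul_le_mul_right _ hR1))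
  have hτ : ∀ U v, ∃ s ∈ extensions k (η v), U ∈ 𝒰 → need U v ⊆ s.1 := by
    intro U v
    by_cases hU : U ∈ 𝒰
    · obtain ⟨s, hs, hs'⟩ := exists_extension hjk hkn (η v) (need U v) ((hlink U hU).1 v)
        ((hlink U hU).2.1 v)
      exact ⟨s, hs, fun _ => hs'⟩
    · obtain ⟨s, hs, -⟩ := exists_extension hjk hkn (η v) ∅ (Finset.empty_subset _) (by simp)
      exact ⟨s, hs, fun h => absurd h hU⟩
  choose τ hτ1 hτ2 using hτ
  have hmain := card_filter_forall_exists_ne_le (fun v => extensions k (η v)) _ M hc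
    (fun v => card_extensions_le (η v)) 𝒰 hdisj hUM τ fun U _ v => hτ1 U v
  have hUR : t * R.card ≤ 𝒰.card := by
    have : 2 * n * M * (t * R.card) ≤ 2 * n * M * 𝒰.card := by
      refine le_trans (le_of_eq ?_) (hRt.trans hcard)
      ring
    exact Nat.le_of_mul_le_mul_left this (by positivity)
  refine le_trans (Nat.cast_le.2 (Finset.card_le_card fun ω hω => ?_)) (hmain.trans ?_)
  · obtain ⟨hω1, A', B', hc', -, he⟩ := Finset.mem_filter.1 hω
    refine Finset.mem_filter.2 ⟨hω1, fun U hU => ?_⟩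
    obtain ⟨v, hv, hne⟩ := (hlink U hU).2.2 _ A' B' hc' (he ▸ Finset.sdiff_subset)
      (hBeq A' B' _ hc' he)
    exact ⟨v, hv, fun h => hne (by unfold chosen; rw [h]; exact hτ2 U v hU)⟩
  · unfold missProb
    rw [← pow_mul]
    refine mul_le_mul (pow_le_pow_of_le_one h1c ?_ hUR) (card_extensions_le_pow η)
      (Nat.cast_nonneg _) (pow_nonneg h1c _)
    rw [sub_le_self_iff]
    positivity

lemma sum_nonempty_pow_card {α : Type*} [Fintype α] [DecidableEq α] (q : ℝ) :
    ∑ R ∈ Finset.univ.filter (fun R : Finset α => R.Nonempty), q ^ R.card =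
      (1 + q) ^ Fintype.card α - 1 := by
  have h1 := Fintype.sum_pow_mul_eq_add_pow α q 1
  have h2 : Finset.univ.filter (fun R : Finset α => R.Nonempty) = Finset.univ.erase ∅ := by
    ext R
    simp [Finset.nonempty_iff_ne_empty]
  rw [h2, ← Finset.sum_erase_add _ _ (Finset.mem_univ (∅ : Finset α))] at *
  simp only [one_pow, mul_one, Finset.card_empty, pow_zero] at h1
  rw [add_comm q 1] at h1
  linarith

/-- The extension leaves a cut after removing `S`, but no small closed set. -/
def LeavesCut (M : ℕ) (S : Finset (Vtx n)) (ω : KOut n k) : Prop :=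
  (∃ A B, IsCut (chosen ω) S A B ∧ A.Nonempty ∧ B.Nonempty) ∧
    ¬ ∃ D, IsSmallClosed (chosen ω) S M D

lemma card_extensions_leavesCut_le {L t : ℕ} (hjk : j + 2 ≤ k) (hkn : k ≤ n) (hM : 1 ≤ M)
    (hML : 2 * M ≤ L) (ht : t * ((n * M + 1) * (2 * n * M)) ≤ L) (hkt : k ≤ t) (η : KOut n j)
    {S : Finset (Vtx n)} (hS : S.card < k)
    (hgap : ∀ D, QConn D → IsClosedOff (chosen η) S D → M ≤ D.card → L < D.card) :
    (((Fintype.piFinset fun v => extensions k (η v)).filter (LeavesCut M S)).card : ℝ) ≤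
      ((1 + missProb ((n - j).choose (k - j)) M t) ^ 2 ^ n - 1) *
        ((n - j).choose (k - j) : ℝ) ^ 2 ^ n := by
  obtain ⟨W, Bk, hb⟩ := exists_blocks (chosen η) S M L hML hgap
  have hη : ∀ v, chosen η v ⊆ nbrs v := fun v => choice_subset_nbrs (η v)
  set q := missProb ((n - j).choose (k - j)) M t with hq
  have hq0 : 0 ≤ q := pow_nonneg (one_sub_nonneg_of_one_le (Nat.choose_pos (by omega)) M) _
  set c := ((n - j).choose (k - j) : ℝ) ^ 2 ^ n with hc
  set E := Fintype.piFinset fun v => extensions k (η v) with hE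
  set P : Finset (Vtx n) → Finset (KOut n k) := fun R => E.filter fun ω =>
      R.card * L ≤ (n * M + 1) * (R.biUnion (comp (chosen η) S) \ W).card ∧
      ∃ A B, IsCut (chosen ω) S A B ∧ (A \ W).card ≤ (B \ W).card ∧
        A \ W = R.biUnion (comp (chosen η) S) \ W with hP
  have hsub : E.filter (LeavesCut M S) ⊆
      (Finset.univ.filter fun R : Finset (Vtx n) => R.Nonempty).biUnion P := by
    intro ω hω
    obtain ⟨hωE, ⟨A, B, hcut, hA, hB⟩, hno⟩ := Finset.mem_filter.1 hω
    have hext : ∀ v, chosen η v ⊆ chosen ω v := fun v =>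
      (Finset.mem_filter.1 (Fintype.mem_piFinset.1 hωE v)).2
    have key : ∀ A B, IsCut (chosen ω) S A B → A.Nonempty → (A \ W).card ≤ (B \ W).card →
        ω ∈ (Finset.univ.filter fun R : Finset (Vtx n) => R.Nonempty).biUnion P := by
      intro A B hcut hA hle
      have hAW : (A \ W).Nonempty := by
        rw [Finset.sdiff_nonempty]
        exact fun h => hno (exists_small_closed_of_subset hb
          (fun v => choice_subset_nbrs (ω v)) hcut hA h)
      obtain ⟨R, hR, heq, hRL⟩ := hcut.exists_representatives hb hη hgap hext hAW
      refine Finset.mem_biUnion.2 ⟨R, Finset.mem_filter.2 ⟨Finset.mem_univ _, hR⟩,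
        Finset.mem_filter.2 ⟨hωE, heq ▸ hRL, A, B, hcut, hle, heq⟩⟩
    rcases le_total (A \ W).card (B \ W).card with h | h
    · exact key A B hcut hA h
    · exact key B A hcut.symm hB h
  have hcard : ∀ R : Finset (Vtx n), R.Nonempty → ((P R).card : ℝ) ≤ q ^ R.card * c := by
    intro R hR
    by_cases hRL : R.card * L ≤ (n * M + 1) * (R.biUnion (comp (chosen η) S) \ W).card
    · refine le_trans (Nat.cast_le.2 (Finset.card_le_card fun ω hω => ?_))
        (card_extensions_cut_eq_le hjk hkn hM ht hkt η hS hb hR hRL)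
      obtain ⟨h1, -, h2⟩ := Finset.mem_filter.1 hω
      exact Finset.mem_filter.2 ⟨h1, h2⟩
    · have : P R = ∅ := Finset.filter_false_of_mem fun ω _ h => hRL h.1
      rw [this]
      simp only [Finset.card_empty, Nat.cast_zero]
      positivity
  have h1 : ((E.filter (LeavesCut M S)).card : ℝ) ≤
      ∑ R ∈ Finset.univ.filter (fun R : Finset (Vtx n) => R.Nonempty), ((P R).card : ℝ) := by
    exact_mod_cast (Finset.card_le_card hsub).trans Finset.card_biUnion_le
  refine h1.trans ((Finset.sum_le_sum fun R hR => hcard R (Finset.mem_filter.1 hR).2).trans ?_)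
  rw [← Finset.sum_mul, sum_nonempty_pow_card]
  simp

lemma card_filter_card_lt_le (hkn : k ≤ n) :
    (Finset.univ.filter fun S : Finset (Vtx n) => S.card < k).card ≤ n * (2 ^ n) ^ n := by
  have hsub : (Finset.univ.filter fun S : Finset (Vtx n) => S.card < k) ⊆
      (Finset.range n).biUnion fun i => Finset.univ.powersetCard i := by
    intro S hS
    have := (Finset.mem_filter.1 hS).2
    exact Finset.mem_biUnion.2 ⟨S.card, Finset.mem_range.2 (by omega),
      Finset.mem_powersetCard.2 ⟨Finset.subset_univ _, rfl⟩⟩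
  refine (Finset.card_le_card hsub).trans ((Finset.card_biUnion_le_card_mul _ _
    ((2 ^ n) ^ n) fun i hi => ?_).trans (by rw [Finset.card_range]))
  rw [Finset.card_powersetCard]
  refine (Nat.choose_le_pow _ _).trans ?_
  simp only [Finset.card_univ, Fintype.card_fun, Fintype.card_bool, Fintype.card_fin]
  exact Nat.pow_le_pow_right (by positivity) (Finset.mem_range.1 hi).le

theorem card_extensions_exists_leavesCut_le {L t : ℕ} (hjk : j + 2 ≤ k) (hkn : k ≤ n)
    (hM : 1 ≤ M) (hML : 2 * M ≤ L) (ht : t * ((n * M + 1) * (2 * n * M)) ≤ L) (hkt : k ≤ t)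
    (η : KOut n j)
    (hgap : ∀ S D : Finset (Vtx n), S.card < k → QConn D → IsClosedOff (chosen η) S D →
      M ≤ D.card → L < D.card) :
    (((Fintype.piFinset fun v => extensions k (η v)).filter fun ω =>
      ∃ S : Finset (Vtx n), S.card < k ∧ LeavesCut M S ω).card : ℝ) ≤
      (n * (2 ^ n) ^ n * ((1 + missProb ((n - j).choose (k - j)) M t) ^ 2 ^ n - 1)) *
        ((n - j).choose (k - j) : ℝ) ^ 2 ^ n := by
  have hsub : ((Fintype.piFinset fun v => extensions k (η v)).filter fun ω =>
      ∃ S : Finset (Vtx n), S.card < k ∧ LeavesCut M S ω) ⊆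
      (Finset.univ.filter fun S : Finset (Vtx n) => S.card < k).biUnion fun S =>
        (Fintype.piFinset fun v => extensions k (η v)).filter (LeavesCut M S) := by
    intro ω hω
    obtain ⟨h1, S, hS, h2⟩ := Finset.mem_filter.1 hω
    exact Finset.mem_biUnion.2 ⟨S, Finset.mem_filter.2 ⟨Finset.mem_univ _, hS⟩,
      Finset.mem_filter.2 ⟨h1, h2⟩⟩
  have h1 := (Finset.card_le_card hsub).trans Finset.card_biUnion_le
  refine (Nat.cast_le.2 h1).trans ?_
  rw [Nat.cast_sum]
  refine (Finset.sum_le_card_nsmul _ _ _ fun S hS => card_extensions_leavesCut_le hjk hkn hM hML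
    ht hkt η (Finset.mem_filter.1 hS).2 fun D => hgap S D (Finset.mem_filter.1 hS).2).trans ?_
  rw [nsmul_eq_mul, ← mul_assoc]
  refine mul_le_mul_of_nonneg_right (mul_le_mul_of_nonneg_right ?_ ?_) (by positivity)
  · exact_mod_cast card_filter_card_lt_le hkn
  · rw [sub_nonneg]
    refine one_le_pow₀ (le_add_of_nonneg_right ?_)
    exact pow_nonneg (one_sub_nonneg_of_one_le (Nat.choose_pos (by omega)) M) _

end Extensions

/-! ### A bound on the failure probability -/

lemma exists_isCut_of_not_isLConnected {n k : ℕ} (hkn : k ≤ n) (ω : KOut n k)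
    (h : ¬ IsLConnected (kOutGraph n k ω) k) :
    ∃ S : Finset (Vtx n), S.card < k ∧
      ∃ A B, IsCut (chosen ω) S A B ∧ A.Nonempty ∧ B.Nonempty := by
  have hcard : k < Fintype.card (Vtx n) := by
    simpa using hkn.trans_lt Nat.lt_two_pow_self
  simp only [IsLConnected, hcard, true_and] at h
  push Not at h
  obtain ⟨S, hS, hcon⟩ := h
  refine ⟨S, hS, ?_⟩
  have hne : ∃ v, v ∉ S := by
    by_contra hall
    push Not at hall
    have := Finset.eq_univ_iff_forall.2 hall
    rw [this, Finset.card_univ] at hS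
    omega
  rw [SimpleGraph.connected_iff, not_and_or] at hcon
  replace hcon := hcon.resolve_right (fun hn => hn
    ⟨⟨hne.choose, by simpa using hne.choose_spec⟩⟩)
  unfold SimpleGraph.Preconnected at hcon
  push Not at hcon
  obtain ⟨x, y, hxy⟩ := hcon
  set G := (kOutGraph n k ω).induce ((↑S : Set (Vtx n))ᶜ) with hG
  set A : Finset (Vtx n) := Finset.univ.filter fun v =>
    ∃ h : v ∈ ((↑S : Set (Vtx n))ᶜ), G.Reachable x ⟨v, h⟩ with hA
  have memA : ∀ v, v ∈ A ↔ ∃ h : v ∈ ((↑S : Set (Vtx n))ᶜ), G.Reachable x ⟨v, h⟩ := by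
    intro v; simp [hA]
  have hstep : ∀ u v, u ∈ A → v ∉ S → (v ∈ chosen ω u ∨ u ∈ chosen ω v) → v ∈ A := by
    intro u v hu hv huv
    obtain ⟨hu1, hu2⟩ := (memA u).1 hu
    refine (memA v).2 ⟨by simpa using hv, hu2.trans (SimpleGraph.Adj.reachable ?_)⟩
    rw [hG, SimpleGraph.comap_adj]
    refine (SimpleGraph.fromRel_adj _ _ _).2 ⟨?_, huv⟩
    rintro rfl
    rcases huv with h | h
    · exact not_mem_nbrs_self u (choice_subset_nbrs (ω u) h)
    · exact not_mem_nbrs_self u (choice_subset_nbrs (ω u) h)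
  have hAS : ∀ v ∈ A, v ∉ S := fun v hv => by simpa using ((memA v).1 hv).1
  refine ⟨A, Sᶜ \ A, ⟨?_, hAS, ?_, ?_, ?_, ?_⟩, ⟨x.1, (memA _).2 ⟨x.2, .refl _⟩⟩, ⟨y.1, ?_⟩⟩
  · intro v hv
    by_cases h : v ∈ A
    · exact Or.inl h
    · exact Or.inr (Finset.mem_sdiff.2 ⟨Finset.mem_compl.2 hv, h⟩)
  · exact fun v hv => Finset.mem_compl.1 (Finset.mem_sdiff.1 hv).1
  · exact fun v hv h => (Finset.mem_sdiff.1 h).2 hv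
  · intro v hv u hu huB
    rw [Finset.mem_sdiff, Finset.mem_compl] at huB
    exact huB.2 (hstep v u hv huB.1 (Or.inl hu))
  · intro v hv u hu huA
    rw [Finset.mem_sdiff, Finset.mem_compl] at hv
    exact hv.2 (hstep u v huA hv.1 (Or.inr hu))
  · rw [Finset.mem_sdiff, Finset.mem_compl]
    refine ⟨fun h => y.2 (Finset.mem_coe.2 h), fun h => hxy ?_⟩
    exact ((memA _).1 h).2

/-- The union bound for connected sets of size `d` whose choices leave through at most `r`
vertices. -/
def closedBound (n k r d : ℕ) : ℝ :=
  2 ^ n * n ^ (2 * d) * (d * (n + 1)) ^ r *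
    (((d + r : ℕ) * Real.logb 2 (d + r : ℕ)) / (d * n)) ^ (k * d)

lemma prob_exists_hasClosed_le {n k r : ℕ} (hk : k ≤ n) (hn : 1 ≤ n) (I : Finset ℕ)
    (hI : ∀ d ∈ I, 1 ≤ d) :
    prob (fun ω : KOut n k => ∃ d ∈ I, HasClosed k r d ω) ≤ ∑ d ∈ I, closedBound n k r d :=
  (prob_exists_le_sum I fun d ω => HasClosed k r d ω).trans
    (Finset.sum_le_sum fun d hd => prob_hasClosed_le hk hn (hI d hd))

lemma IsSmallClosed.lt_logb {n k M : ℕ} (hk : 128 ≤ k) {ω : KOut n k} {S D : Finset (Vtx n)}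
    (hS : S.card < k) (h : IsSmallClosed (chosen ω) S M D) :
    (k : ℝ) - 1 / 2 < Real.logb 2 D.card := by
  refine lt_logb_card_of_closed hk h.1.1 hS (Finset.disjoint_left.2 fun v hv => (h.2.1 v hv).1)
    fun v hv => ?_
  rw [← (ω v).2.1]
  exact Finset.card_le_card (Finset.subset_inter (choice_subset_nbrs (ω v)) (h.2.1 v hv).2)

/-- The failure probability when all the connected sets with few exits in `Q^n(j)` that have at
least `M` elements have more than `L` elements. -/
lemma prob_exists_leavesCut_le {n j k M L t : ℕ} (hjk : j + 2 ≤ k) (hkn : k ≤ n) (hM : 1 ≤ M)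
    (hML : 2 * M ≤ L) (ht : t * ((n * M + 1) * (2 * n * M)) ≤ L) (hkt : k ≤ t) :
    prob (fun ω : KOut n k => ∃ S : Finset (Vtx n), S.card < k ∧ LeavesCut M S ω) ≤
      ∑ d ∈ Finset.Icc M L, closedBound n j k d +
        n * (2 ^ n) ^ n * ((1 + missProb ((n - j).choose (k - j)) M t) ^ 2 ^ n - 1) := by
  have hjn : j ≤ n := by omega
  have hn : 1 ≤ n := by omega
  have hc : 1 ≤ (n - j).choose (k - j) := Nat.choose_pos (by omega)
  have hq : 0 ≤ missProb ((n - j).choose (k - j)) M t :=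
    pow_nonneg (one_sub_nonneg_of_one_le hc M) t
  have hpow : 0 ≤ (1 + missProb ((n - j).choose (k - j)) M t) ^ 2 ^ n - 1 :=
    sub_nonneg.2 (one_le_pow₀ (le_add_of_nonneg_right hq))
  have hε : 0 ≤ n * (2 ^ n) ^ n * ((1 + missProb ((n - j).choose (k - j)) M t) ^ 2 ^ n - 1) :=
    mul_nonneg (by positivity) hpow
  have hext := prob_le_prob_add_of_extensions (j := j) (by omega) hkn
    (fun ω : KOut n k => ∃ S : Finset (Vtx n), S.card < k ∧ LeavesCut M S ω)
    (fun η : KOut n j => ∃ d ∈ Finset.Icc M L, HasClosed j k d η) _ hε fun η hη =>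
      card_extensions_exists_leavesCut_le hjk hkn hM hML ht hkt η fun S D hS hD hc hMD => by
        by_contra hlt
        exact hη ⟨D.card, Finset.mem_Icc.2 ⟨hMD, not_lt.1 hlt⟩, D, S, hD, rfl, hS.le,
          fun v hv => (hc v hv).2⟩
  refine hext.trans (add_le_add_left ?_ _)
  exact prob_exists_hasClosed_le hjn hn _ fun d hd => hM.trans (Finset.mem_Icc.1 hd).1

theorem prob_not_isLConnected_le {n j k M L t : ℕ} (hk : 128 ≤ k) (hjk : j + 2 ≤ k) (hkn : k ≤ n)
    (hM : 1 ≤ M) (hML : 2 * M ≤ L) (ht : t * ((n * M + 1) * (2 * n * M)) ≤ L) (hkt : k ≤ t) :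
    prob (fun ω : KOut n k => ¬ IsLConnected (kOutGraph n k ω) k) ≤
      ∑ d ∈ (Finset.range M).filter (fun d : ℕ => (k : ℝ) - 1 / 2 < Real.logb 2 d),
        closedBound n k k d +
      (∑ d ∈ Finset.Icc M L, closedBound n j k d +
        n * (2 ^ n) ^ n * ((1 + missProb ((n - j).choose (k - j)) M t) ^ 2 ^ n - 1)) := by
  have hcover : prob (fun ω : KOut n k => ¬ IsLConnected (kOutGraph n k ω) k) ≤
      prob (fun ω : KOut n k =>
        (∃ d ∈ (Finset.range M).filter (fun d : ℕ => (k : ℝ) - 1 / 2 < Real.logb 2 d),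
          HasClosed k k d ω) ∨ ∃ S : Finset (Vtx n), S.card < k ∧ LeavesCut M S ω) := by
    refine prob_mono fun ω hω => ?_
    obtain ⟨S, hS, hcut⟩ := exists_isCut_of_not_isLConnected hkn ω hω
    by_cases hD : ∃ D, IsSmallClosed (chosen ω) S M D
    · obtain ⟨D, hD⟩ := hD
      refine Or.inl ⟨D.card, Finset.mem_filter.2 ⟨Finset.mem_range.2 hD.2.2, hD.lt_logb hk hS⟩,
        D, S, hD.1, rfl, hS.le, fun v hv => (hD.2.1 v hv).2⟩
    · exact Or.inr ⟨S, hS, hcut, hD⟩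
  refine hcover.trans ((prob_or_le _ _).trans (add_le_add ?_ ?_))
  · refine prob_exists_hasClosed_le hkn (by omega) _ fun d hd => ?_
    by_contra hlt
    have h0 : d = 0 := by omega
    have := (Finset.mem_filter.1 hd).2
    rw [h0] at this
    have hk' : (128 : ℝ) ≤ k := by exact_mod_cast hk
    simp at this
    linarith
  · exact prob_exists_leavesCut_le hjk hkn hM hML ht hkt

/-! ### Asymptotic estimates -/

/-- The requirements on `n` under which the union bounds are small. -/
structure IsLarge (n : ℕ) : Prop where
  le_logb : 10 ^ 5 ≤ Real.logb 2 n
  logb_pow_le : 10 ^ 12 * Real.logb 2 n ^ 4 ≤ n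
  logb_logb_le : Real.logb 2 (Real.logb 2 n) ≤ Real.logb 2 n / 100

lemma tendsto_logb_two_natCast : Tendsto (fun n : ℕ => Real.logb 2 n) atTop atTop :=
  (Real.tendsto_logb_atTop one_lt_two).comp tendsto_natCast_atTop_atTop

lemma eventually_mul_log_pow_le (C : ℝ) (p : ℕ) : ∀ᶠ x : ℝ in atTop, C * Real.log x ^ p ≤ x := by
  have h := (Real.isLittleO_pow_log_id_atTop (n := p)).const_mul_left C
  filter_upwards [h.bound one_pos, eventually_ge_atTop 0] with x hx hx0
  rw [one_mul, id, Real.norm_of_nonneg hx0] at hx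
  exact (le_abs_self _).trans hx

lemma eventually_isLarge : ∀ᶠ n : ℕ in atTop, IsLarge n := by
  have h1 := tendsto_logb_two_natCast.eventually_ge_atTop (10 ^ 5)
  have h2 := (tendsto_natCast_atTop_atTop (R := ℝ)).eventually
    (eventually_mul_log_pow_le (10 ^ 12 / Real.log 2 ^ 4) 4)
  have h3 := tendsto_logb_two_natCast.eventually
    (eventually_mul_log_pow_le (100 / Real.log 2) 1)
  filter_upwards [h1, h2, h3] with n h1 h2 h3
  refine ⟨h1, ?_, ?_⟩
  · calc _ = 10 ^ 12 / Real.log 2 ^ 4 * Real.log n ^ 4 := by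
          rw [Real.logb, div_pow]; ring
      _ ≤ n := h2
  · rw [le_div_iff₀ (by norm_num)]
    calc _ = 100 / Real.log 2 * Real.log (Real.logb 2 n) ^ 1 := by
          rw [Real.logb]; ring
      _ ≤ _ := h3

namespace IsLarge

lemma pos {n : ℕ} (h : IsLarge n) : 0 < n := by
  rcases Nat.eq_zero_or_pos n with rfl | h0
  · have := h.le_logb
    norm_num at this
  · exact h0

lemma rpow_logb {n : ℕ} (h : IsLarge n) : (2 : ℝ) ^ Real.logb 2 n = n :=
  Real.rpow_logb two_pos (by norm_num) (by exact_mod_cast h.pos)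

lemma logb_sq_le {n : ℕ} (h : IsLarge n) : 10 ^ 16 * Real.logb 2 n ^ 2 ≤ n := by
  have h1 := h.le_logb
  have h2 := h.logb_pow_le
  have h3 : (10 ^ 5 : ℝ) ^ 2 ≤ Real.logb 2 n ^ 2 := pow_le_pow_left₀ (by norm_num) h1 2
  nlinarith [sq_nonneg (Real.logb 2 (n : ℝ))]

lemma logb_le {n : ℕ} (h : IsLarge n) : 10 ^ 20 * Real.logb 2 n ≤ n := by
  have h1 := h.le_logb
  have h2 := h.logb_sq_le
  nlinarith

lemma large {n : ℕ} (h : IsLarge n) : (10 ^ 24 : ℝ) ≤ n := by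
  have h1 := h.le_logb
  have h2 := h.logb_le
  linarith

lemma add_one_le_sq {n : ℕ} (h : IsLarge n) : (n : ℝ) + 1 ≤ n ^ 2 := by
  have := h.large
  nlinarith

lemma pow_eq_rpow {n : ℕ} (h : IsLarge n) (m : ℕ) : (n : ℝ) ^ m = 2 ^ (m * Real.logb 2 n) := by
  rw [mul_comm, Real.rpow_mul two_pos.le, h.rpow_logb, Real.rpow_natCast]

lemma rpow_neg_logb {n : ℕ} (h : IsLarge n) : (2 : ℝ) ^ (-Real.logb 2 n) = 1 / n := by
  rw [Real.rpow_neg two_pos.le, h.rpow_logb, one_div]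

end IsLarge

lemma closedBound_le_rpow {n k r d : ℕ} (hn : IsLarge n) {β γ : ℝ}
    (hβ : ((d + r : ℕ) * Real.logb 2 (d + r : ℕ)) / (d * n) ≤ (2 : ℝ) ^ (-β))
    (hγ : (d * (n + 1) : ℝ) ≤ 2 ^ γ) :
    closedBound n k r d ≤ 2 ^ (n + 2 * d * Real.logb 2 n + r * γ - k * d * β) := by
  have h0 : 0 ≤ ((d + r : ℕ) * Real.logb 2 (d + r : ℕ)) / (d * n : ℝ) := by
    refine div_nonneg (mul_nonneg (by positivity) ?_) (by positivity)
    rcases Nat.eq_zero_or_pos (d + r) with h | h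
    · simp [h]
    · exact Real.logb_nonneg one_lt_two (by exact_mod_cast h)
  have h1 : (2 : ℝ) ^ (n + 2 * d * Real.logb 2 n + r * γ - k * d * β) =
      2 ^ n * n ^ (2 * d) * (2 ^ γ) ^ r * (2 ^ (-β)) ^ (k * d) := by
    rw [hn.pow_eq_rpow, ← Real.rpow_natCast 2 n, ← Real.rpow_natCast (2 ^ γ),
      ← Real.rpow_natCast (2 ^ (-β)), ← Real.rpow_mul two_pos.le, ← Real.rpow_mul two_pos.le,
      ← Real.rpow_add two_pos, ← Real.rpow_add two_pos, ← Real.rpow_add two_pos]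
    congr 1
    push_cast
    ring
  rw [h1, closedBound]
  have h2 : ((d : ℝ) * (n + 1)) ^ r ≤ (2 ^ γ) ^ r := pow_le_pow_left₀ (by positivity) hγ r
  have h3 := pow_le_pow_left₀ h0 hβ (k * d)
  exact mul_le_mul (mul_le_mul_of_nonneg_left h2 (by positivity)) h3 (pow_nonneg h0 _)
    (by positivity)

/-- Small sets with at least `√2 n / log² n` elements. -/
lemma closedBound_le_of_lt_logb {n k d : ℕ} (hn : IsLarge n)
    (hk : Real.logb 2 n - 2 * Real.logb 2 (Real.logb 2 n) + 1 ≤ k)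
    (hd : 1024 * Real.logb 2 n * d ≤ n) (hkd : (k : ℝ) - 1 / 2 < Real.logb 2 d) :
    closedBound n k k d ≤ 2 ^ (-(n / 10) : ℝ) := by
  have hl := hn.le_logb
  have hla := hn.logb_logb_le
  have hn1 := hn.logb_pow_le
  have hn2 := hn.logb_sq_le
  have hsq := hn.add_one_le_sq
  have hpow := hn.rpow_logb
  have hn3 := hn.pow_eq_rpow 3
  have hnpos : (0 : ℝ) < n := by exact_mod_cast hn.pos
  set l := Real.logb 2 (n : ℝ) with hl_def
  have hlpos : 0 < l := by linarith
  have hlam : (2 : ℝ) ^ Real.logb 2 l = l :=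
    Real.rpow_logb two_pos (by norm_num) hlpos
  have hlam0 : 0 ≤ Real.logb 2 l := Real.logb_nonneg one_lt_two (by linarith)
  set a := Real.logb 2 l with ha_def
  have hd0 : d ≠ 0 := by
    rintro rfl
    simp at hkd
    linarith
  have hdpos : (0 : ℝ) < d := by exact_mod_cast Nat.pos_of_ne_zero hd0
  have hdn : (d : ℝ) * 2 ≤ n := by nlinarith
  have hkl : (k : ℝ) ≤ l := by
    have h1 : Real.logb 2 (d * 2 : ℝ) ≤ l :=
      Real.logb_le_logb_of_le one_lt_two (by positivity) hdn
    rw [Real.logb_mul hdpos.ne' two_ne_zero, Real.logb_self_eq_one one_lt_two] at h1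
    linarith
  have hlow : 1.4 * n ≤ l ^ 2 * d := by
    have h1 : (2 : ℝ) ^ (l - 2 * a + 1 / 2) ≤ d := by
      rw [← Real.le_logb_iff_rpow_le one_lt_two hdpos]
      linarith
    have h2 : (2 : ℝ) ^ (l - 2 * a + 1 / 2) * l ^ 2 = n * √2 := by
      have : l ^ 2 = (2 : ℝ) ^ (2 * a) := by
        rw [mul_comm, Real.rpow_mul two_pos.le, hlam]
        norm_num
      rw [this, ← Real.rpow_add two_pos, show l - 2 * a + 1 / 2 + 2 * a = l + 1 / 2 by ring,
        Real.rpow_add two_pos, hpow, Real.sqrt_eq_rpow]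
    have h3 : 1.4 ≤ √2 := Real.le_sqrt_of_sq_le (by norm_num)
    nlinarith [sq_nonneg l]
  have hkd' : (k : ℝ) ≤ d := by
    have : l ^ 2 * l ≤ l ^ 2 * d := by nlinarith [pow_pos hlpos 3, pow_pos hlpos 4]
    exact hkl.trans (le_of_mul_le_mul_left this (by positivity))
  have hbase : ((d + k : ℕ) * Real.logb 2 (d + k : ℕ)) / (d * n : ℝ) ≤
      (2 : ℝ) ^ (-(l - 1 - a)) := by
    have h1 : (2 : ℝ) ^ (-(l - 1 - a)) = 2 * l / n := by
      rw [show -(l - 1 - a) = 1 + a - l by ring, Real.rpow_sub two_pos, Real.rpow_add two_pos,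
        hlam, hpow, Real.rpow_one]
    have h2 : ((d + k : ℕ) : ℝ) ≤ 2 * d := by push_cast; linarith
    have h3 : Real.logb 2 (d + k : ℕ) ≤ l :=
      Real.logb_le_logb_of_le one_lt_two (by push_cast; positivity) (by linarith)
    rw [h1, div_le_div_iff₀ (by positivity) hnpos]
    have h4 : ((d + k : ℕ) : ℝ) * Real.logb 2 (d + k : ℕ) ≤ 2 * d * l :=
      (mul_le_mul_of_nonneg_left h3 (by positivity)).trans
        (mul_le_mul_of_nonneg_right h2 hlpos.le)
    nlinarith
  have hγ : (d * (n + 1) : ℝ) ≤ 2 ^ (3 * l) := by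
    have : (2 : ℝ) ^ (3 * l) = n ^ 3 := by rw [hn3]; norm_num
    rw [this]
    calc (d * (n + 1) : ℝ) ≤ n * n ^ 2 := mul_le_mul (by linarith) hsq (by positivity) hnpos.le
      _ = n ^ 3 := by ring
  refine (closedBound_le_rpow hn hbase hγ).trans
    (Real.rpow_le_rpow_of_exponent_le one_le_two ?_)
  have h1 : (l ^ 2 - 3 * a * l - 1) ≤ k * (l - 1 - a) := by
    have : (l - 2 * a + 1) * (l - 1 - a) ≤ k * (l - 1 - a) :=
      mul_le_mul_of_nonneg_right hk (by linarith)
    nlinarith [sq_nonneg a]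
  have h2 : 0.9 * l ^ 2 ≤ k * (l - 1 - a) - 2 * l := by nlinarith
  have h3 : 0.9 * l ^ 2 * d ≤ (k * (l - 1 - a) - 2 * l) * d :=
    mul_le_mul_of_nonneg_right h2 hdpos.le
  have h4 : (k : ℝ) * (3 * l) ≤ l * (3 * l) := mul_le_mul_of_nonneg_right hkl (by linarith)
  linarith

/-- Connected sets of size between `M` and `n²`. -/
lemma closedBound_le_of_le_sq {n j k d : ℕ} (hn : IsLarge n) (hkn : k ≤ n) (hkj : k ≤ j + 2)
    (hj : Real.logb 2 n * 0.9 ≤ j) (hd : (n : ℝ) ≤ 6000 * Real.logb 2 n * d)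
    (hdn : (d : ℝ) ≤ n ^ 2) : closedBound n j k d ≤ 2 ^ (-d : ℝ) := by
  have hl := hn.le_logb
  have hn1 := hn.logb_pow_le
  have hn2 := hn.logb_sq_le
  have hsq := hn.add_one_le_sq
  have hpow := hn.rpow_logb
  have hn3 := hn.pow_eq_rpow 3
  have hn4 := hn.pow_eq_rpow 4
  have hlarge := hn.large
  have hnpos : (0 : ℝ) < n := by exact_mod_cast hn.pos
  set l := Real.logb 2 (n : ℝ) with hl_def
  have hlpos : 0 < l := by linarith
  have hkn' : (k : ℝ) ≤ n := by exact_mod_cast hkn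
  have hkj' : (k : ℝ) ≤ j + 2 := by exact_mod_cast hkj
  have hd100 : (100 : ℝ) ≤ d := by
    have : l * 100 ≤ l * d := by nlinarith
    exact le_of_mul_le_mul_left this hlpos
  have hdpos : (0 : ℝ) < d := by linarith
  have hbase : ((d + k : ℕ) * Real.logb 2 (d + k : ℕ)) / (d * n : ℝ) ≤
      (2 : ℝ) ^ (-(l / 2)) := by
    have h1 : (2 : ℝ) ^ (-(l / 2)) = √n / n := by
      rw [Real.sqrt_eq_rpow, ← hpow, ← Real.rpow_mul two_pos.le, ← Real.rpow_sub two_pos]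
      congr 1
      ring
    have h2 : ((d + k : ℕ) : ℝ) ≤ (1 + 6000 * l) * d := by push_cast; linarith
    have h3 : Real.logb 2 (d + k : ℕ) ≤ 3 * l := by
      rw [Real.logb_le_iff_le_rpow one_lt_two (by push_cast; positivity)]
      have : (2 : ℝ) ^ (3 * l) = n ^ 3 := by rw [hn3]; norm_num
      rw [this]
      push_cast
      nlinarith [sq_nonneg (n : ℝ)]
    have h4 : ((d + k : ℕ) : ℝ) * Real.logb 2 (d + k : ℕ) ≤ (1 + 6000 * l) * d * (3 * l) :=
      (mul_le_mul_of_nonneg_left h3 (by positivity)).trans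
        (mul_le_mul_of_nonneg_right h2 (by positivity))
    have h5 : (1 + 6000 * l) * (3 * l) ≤ √n := by
      refine (?_ : _ ≤ 10 ^ 6 * l ^ 2).trans (Real.le_sqrt_of_sq_le ?_)
      · nlinarith
      · linarith
    rw [h1, div_le_div_iff₀ (by positivity) hnpos]
    calc _ ≤ (1 + 6000 * l) * d * (3 * l) * n := mul_le_mul_of_nonneg_right h4 hnpos.le
      _ = (1 + 6000 * l) * (3 * l) * (d * n) := by ring
      _ ≤ _ := mul_le_mul_of_nonneg_right h5 (by positivity)
  have hγ : (d * (n + 1) : ℝ) ≤ 2 ^ (4 * l) := by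
    have : (2 : ℝ) ^ (4 * l) = n ^ 4 := by rw [hn4]; norm_num
    rw [this]
    calc (d * (n + 1) : ℝ) ≤ n ^ 2 * n ^ 2 := mul_le_mul hdn hsq (by positivity) (by positivity)
      _ = n ^ 4 := by ring
  refine (closedBound_le_rpow hn hbase hγ).trans
    (Real.rpow_le_rpow_of_exponent_le one_le_two ?_)
  have hj0 : (9 * 10 ^ 4 : ℝ) ≤ j := by linarith
  have hld : 0 < l * d := by positivity
  have h1 : (k : ℝ) * (4 * l) ≤ (j + 2) * (4 * l) :=
    mul_le_mul_of_nonneg_right hkj' (by linarith)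
  have h2 : (j * l) * 100 ≤ (j * l) * d := mul_le_mul_of_nonneg_left hd100 (by positivity)
  have h3 : 9 * 10 ^ 4 * (l * d) ≤ j * (l * d) := mul_le_mul_of_nonneg_right hj0 hld.le
  have h4 : 10 ^ 5 * (d : ℝ) ≤ l * d := mul_le_mul_of_nonneg_right hl hdpos.le
  have h5 : l * 100 ≤ l * d := mul_le_mul_of_nonneg_left hd100 hlpos.le
  linarith

/-- Connected sets of size between `n²` and `2 ^ (n / 64)`. -/
lemma closedBound_le_of_sq_le {n j k d : ℕ} (hn : IsLarge n) (hkn : k ≤ n)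
    (hj : Real.logb 2 n * 0.9 ≤ j) (hd : (n : ℝ) ^ 2 ≤ d)
    (hdn : (d : ℝ) ≤ 2 ^ (n / 64 : ℝ)) :
    closedBound n j k d ≤ 2 ^ (-d : ℝ) := by
  have hl := hn.le_logb
  have hn1 := hn.logb_le
  have hlarge := hn.large
  have hpow := hn.rpow_logb
  have hsq := hn.add_one_le_sq
  have hnpos : (0 : ℝ) < n := by exact_mod_cast hn.pos
  set l := Real.logb 2 (n : ℝ) with hl_def
  have hkn' : (k : ℝ) ≤ n := by exact_mod_cast hkn
  have hdpos : (0 : ℝ) < d := lt_of_lt_of_le (by positivity) hd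
  have hkd : (k : ℝ) ≤ d := by linarith
  have hbase : ((d + k : ℕ) * Real.logb 2 (d + k : ℕ)) / (d * n : ℝ) ≤ (2 : ℝ) ^ (-4 : ℝ) := by
    have h2 : ((d + k : ℕ) : ℝ) ≤ 2 * d := by push_cast; linarith
    have h3 : Real.logb 2 (d + k : ℕ) ≤ n / 64 + 1 := by
      rw [Real.logb_le_iff_le_rpow one_lt_two (by push_cast; positivity),
        Real.rpow_add two_pos, Real.rpow_one]
      linarith
    have h5 : (2 : ℝ) ^ (-4 : ℝ) = 1 / 16 := by
      rw [Real.rpow_neg two_pos.le]; norm_num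
    rw [h5, div_le_iff₀ (by positivity)]
    have h4 : ((d + k : ℕ) : ℝ) * Real.logb 2 (d + k : ℕ) ≤ 2 * d * (n / 64 + 1) :=
      (mul_le_mul_of_nonneg_left h3 (by positivity)).trans
        (mul_le_mul_of_nonneg_right h2 (by positivity))
    nlinarith
  have hγ : (d * (n + 1) : ℝ) ≤ 2 ^ (n : ℝ) := by
    have h1 : (n : ℝ) + 1 ≤ 2 ^ (2 * l) := by
      refine hsq.trans_eq ?_
      rw [hn.pow_eq_rpow, hl_def]; norm_num
    calc (d * (n + 1) : ℝ) ≤ 2 ^ (n / 64 : ℝ) * 2 ^ (2 * l) :=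
          mul_le_mul hdn h1 (by positivity) (by positivity)
      _ = 2 ^ (n / 64 + 2 * l) := by rw [← Real.rpow_add two_pos]
      _ ≤ 2 ^ (n : ℝ) := Real.rpow_le_rpow_of_exponent_le one_le_two (by linarith)
  refine (closedBound_le_rpow hn hbase hγ).trans
    (Real.rpow_le_rpow_of_exponent_le one_le_two ?_)
  have h1 : (k : ℝ) * n ≤ d := (mul_le_mul_of_nonneg_right hkn' hnpos.le).trans (by linarith)
  have h2 : (l * 0.9 * d) ≤ j * d := mul_le_mul_of_nonneg_right hj hdpos.le
  have h3 : (10 ^ 5 * d) ≤ l * d := mul_le_mul_of_nonneg_right hl hdpos.le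
  have h4 : (n : ℝ) ≤ d := by linarith
  linarith

lemma rpow_sub_one_le_two_pow_div (n m : ℕ) (hm : 0 < m) :
    (2 : ℝ) ^ ((n / m : ℝ) - 1) ≤ (2 : ℝ) ^ (n / m) := by
  rw [← Real.rpow_natCast 2 (n / m)]
  refine Real.rpow_le_rpow_of_exponent_le one_le_two ?_
  have hm' : (0 : ℝ) < m := by exact_mod_cast hm
  have h : n < m * (n / m + 1) := by
    have := Nat.div_add_mod n m
    have := Nat.mod_lt n hm
    rw [mul_add]
    omega
  have h' : (n : ℝ) < m * ((n / m : ℕ) + 1) := by exact_mod_cast h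
  have : (n / m : ℝ) ≤ (n / m : ℕ) + 1 := by
    rw [div_le_iff₀ hm']
    linarith
  linarith

lemma missProb_le_exp {n c M : ℕ} (hn : IsLarge n) (hc : 1 ≤ c) (hcn : (c : ℝ) ≤ n ^ 2)
    (hM : 1024 * Real.logb 2 n * M ≤ n) :
    missProb c M (2 ^ (n / 128)) ≤ Real.exp (-n ^ 3) := by
  have h0 := one_sub_nonneg_of_one_le hc M
  have hlarge := hn.large
  have hlog := hn.logb_le
  have hcpos : (0 : ℝ) < c := by exact_mod_cast hc
  have hcM : (c : ℝ) ^ M ≤ 2 ^ (n / 512 : ℝ) := by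
    calc (c : ℝ) ^ M ≤ (n ^ 2) ^ M := pow_le_pow_left₀ hcpos.le hcn M
      _ = 2 ^ ((2 * M : ℕ) * Real.logb 2 n) := by rw [← pow_mul, hn.pow_eq_rpow]
      _ ≤ _ := by
        refine Real.rpow_le_rpow_of_exponent_le one_le_two ?_
        push_cast
        linarith
  have hexp : (n : ℝ) ^ 3 ≤ 1 / (c : ℝ) ^ M * (2 ^ (n / 128) : ℕ) := by
    rw [div_mul_eq_mul_div, one_mul, le_div_iff₀ (by positivity)]
    calc (n : ℝ) ^ 3 * (c : ℝ) ^ M ≤ 2 ^ ((3 : ℕ) * Real.logb 2 n) * 2 ^ (n / 512 : ℝ) := by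
          rw [← hn.pow_eq_rpow]
          exact mul_le_mul_of_nonneg_left hcM (by positivity)
      _ = 2 ^ ((3 : ℕ) * Real.logb 2 n + n / 512) := by rw [← Real.rpow_add two_pos]
      _ ≤ 2 ^ ((n / (128 : ℕ) : ℝ) - 1) := by
        refine Real.rpow_le_rpow_of_exponent_le one_le_two ?_
        push_cast
        linarith
      _ ≤ _ := by
        push_cast
        exact rpow_sub_one_le_two_pow_div n 128 (by norm_num)
  have h1 : 1 - 1 / (c : ℝ) ^ M ≤ Real.exp (-(1 / (c : ℝ) ^ M)) := by
    have := Real.add_one_le_exp (-(1 / (c : ℝ) ^ M))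
    linarith
  refine (pow_le_pow_left₀ h0 h1 _).trans ?_
  rw [← Real.exp_nat_mul]
  exact Real.exp_le_exp.2 (by linarith)

lemma exp_neg_le_two_rpow {x : ℝ} (hx : 0 ≤ x) : Real.exp (-x) ≤ 2 ^ (-x) := by
  rw [Real.rpow_def_of_pos two_pos]
  refine Real.exp_le_exp.2 ?_
  have := Real.log_two_lt_d9
  nlinarith

lemma mul_one_add_pow_sub_one_le {n : ℕ} (hn : IsLarge n) {q : ℝ} (hq0 : 0 ≤ q)
    (hq : q ≤ Real.exp (-n ^ 3)) :
    n * (2 ^ n) ^ n * ((1 + q) ^ 2 ^ n - 1) ≤ 1 / n := by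
  have hlarge := hn.large
  have hlog := hn.logb_le
  have hnpos : (0 : ℝ) < n := by linarith
  have hcube : (n : ℝ) ^ 2 * 10 ≤ n ^ 3 := by nlinarith [sq_nonneg (n : ℝ)]
  have hsq : (n : ℝ) * 10 ≤ n ^ 2 := by nlinarith
  have hy : 2 ^ n * q ≤ (2 : ℝ) ^ (n - n ^ 3 : ℝ) := by
    rw [Real.rpow_sub two_pos, Real.rpow_natCast, div_eq_mul_inv, ← Real.rpow_neg two_pos.le]
    exact mul_le_mul_of_nonneg_left (hq.trans (exp_neg_le_two_rpow (by positivity)))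
      (by positivity)
  have hy0 : 0 ≤ 2 ^ n * q := by positivity
  have hy1 : 2 ^ n * q ≤ 1 := by
    refine hy.trans ?_
    rw [← Real.rpow_zero 2]
    exact Real.rpow_le_rpow_of_exponent_le one_le_two (by linarith)
  have h1 : (1 + q) ^ 2 ^ n - 1 ≤ 2 * (2 ^ n * q) := by
    have h2 : (1 + q) ^ 2 ^ n ≤ Real.exp (2 ^ n * q) := by
      have h3 : 1 + q ≤ Real.exp q := by linarith [Real.add_one_le_exp q]
      refine (pow_le_pow_left₀ (by linarith) h3 _).trans_eq ?_
      rw [← Real.exp_nat_mul]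
      push_cast
      rfl
    have h4 := Real.abs_exp_sub_one_le (x := 2 ^ n * q) (by rwa [abs_of_nonneg hy0])
    rw [abs_of_nonneg hy0] at h4
    linarith [le_abs_self (Real.exp (2 ^ n * q) - 1)]
  calc n * (2 ^ n) ^ n * ((1 + q) ^ 2 ^ n - 1)
      ≤ n * (2 ^ n) ^ n * (2 * 2 ^ (n - n ^ 3 : ℝ)) :=
        mul_le_mul_of_nonneg_left (by linarith) (by positivity)
    _ = 2 ^ (Real.logb 2 n + n ^ 2 + (1 + (n - n ^ 3))) := by
      rw [Real.rpow_add two_pos, Real.rpow_add two_pos, Real.rpow_add two_pos, hn.rpow_logb,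
        Real.rpow_one, ← pow_mul, ← sq, ← Real.rpow_natCast 2 (n ^ 2)]
      push_cast
      rfl
    _ ≤ 2 ^ (-Real.logb 2 n) := Real.rpow_le_rpow_of_exponent_le one_le_two (by linarith)
    _ = 1 / n := hn.rpow_neg_logb

lemma sum_Icc_half_pow_le (M L : ℕ) :
    ∑ d ∈ Finset.Icc M L, (2 : ℝ) ^ (-d : ℝ) ≤ 2 * 2 ^ (-M : ℝ) := by
  have h : ∀ d : ℕ, (2 : ℝ) ^ (-d : ℝ) = (1 / 2) ^ d := fun d => by
    rw [Real.rpow_neg two_pos.le, Real.rpow_natCast, one_div, inv_pow]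
  have := geom_sum_Ico_le_of_lt_one (x := (1 / 2 : ℝ)) (m := M) (n := L + 1) (by norm_num)
    (by norm_num)
  simp only [h]
  rw [← Finset.Ico_succ_right_eq_Icc]
  refine this.trans_eq ?_
  norm_num
  ring

/-- Bounds on the integer part `M` of `n / (1024 * l)`. -/
lemma bounds_of_floor_div {l n M : ℝ} (hl : 1 ≤ l) (hn : 2048 * l ^ 2 ≤ n)
    (h1 : 1024 * l * M ≤ n) (h2 : n ≤ 1024 * l * (M + 1)) :
    l ≤ M ∧ n ≤ 2048 * l * M ∧ M ≤ n := by
  have h3 : 1024 * l * (l + 1) ≤ 1024 * l * (M + 1) := by nlinarith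
  have h4 : l ≤ M := by linarith [le_of_mul_le_mul_left h3 (by positivity)]
  refine ⟨h4, ?_, ?_⟩
  · nlinarith
  · nlinarith

lemma prob_not_isLConnected_le_div {n k : ℕ} (hn : IsLarge n) (hkn : k ≤ n)
    (hk : Real.logb 2 n - 2 * Real.logb 2 (Real.logb 2 n) + 1 ≤ k) :
    prob (fun ω : KOut n k => ¬ IsLConnected (kOutGraph n k ω) k) ≤ 4 / n := by
  have hl := hn.le_logb
  have hll := hn.logb_logb_le
  have hlarge := hn.large
  have hlog := hn.logb_le
  have hlog2 := hn.logb_sq_le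
  have hnpos : (0 : ℝ) < n := by linarith
  have hlpos : 0 < Real.logb 2 n := by linarith
  have hk128 : (128 : ℝ) ≤ k := by linarith
  have hk128' : 128 ≤ k := by exact_mod_cast hk128
  obtain ⟨j, rfl⟩ : ∃ j, k = j + 2 := ⟨k - 2, by omega⟩
  have hj : Real.logb 2 n * 0.9 ≤ j := by
    push_cast at hk
    linarith
  obtain ⟨M, hM1, hM2⟩ : ∃ M : ℕ, 1024 * Real.logb 2 n * M ≤ n ∧
      (n : ℝ) ≤ 1024 * Real.logb 2 n * (M + 1) := by
    refine ⟨⌊(n : ℝ) / (1024 * Real.logb 2 n)⌋₊, ?_, ?_⟩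
    · rw [← le_div_iff₀' (by positivity)]
      exact Nat.floor_le (by positivity)
    · rw [← div_le_iff₀' (by positivity)]
      exact (Nat.lt_floor_add_one _).le
  obtain ⟨hM3, hM4, hMn'⟩ := bounds_of_floor_div (by linarith) (by linarith) hM1 hM2
  have hMn : M ≤ n := by exact_mod_cast hMn'
  have hM5 : 1 ≤ M := by
    have : (1 : ℝ) ≤ M := by linarith
    exact_mod_cast this
  have hdiv : ∀ m : ℕ, (2 : ℝ) ^ (n / m) ≤ 2 ^ (n / m : ℝ) := fun m => by
    rw [← Real.rpow_natCast]
    exact Real.rpow_le_rpow_of_exponent_le one_le_two Nat.cast_div_le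
  have ht : (2 ^ (n / 128)) * ((n * M + 1) * (2 * n * M)) ≤ 2 ^ (n / 64) := by
    have h1 : (n * M + 1 : ℝ) * (2 * n * M) ≤ n ^ 5 := by
      calc (n * M + 1 : ℝ) * (2 * n * M) ≤ (n * n + n * n) * (2 * n * n) := by
            refine mul_le_mul ?_ ?_ (by positivity) (by positivity)
            · refine add_le_add (mul_le_mul_of_nonneg_left hMn' hnpos.le) ?_
              exact (one_le_mul_of_one_le_of_one_le (by linarith) (by linarith))
            · exact mul_le_mul_of_nonneg_left hMn' (by positivity)
        _ = 4 * n ^ 4 := by ring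
        _ ≤ n * n ^ 4 := mul_le_mul_of_nonneg_right (by linarith) (by positivity)
        _ = n ^ 5 := by ring
    have h2 : (2 : ℝ) ^ (n / 128) * ((n * M + 1) * (2 * n * M)) ≤ 2 ^ (n / 64) := by
      calc _ ≤ (2 : ℝ) ^ (n / (128 : ℕ) : ℝ) * 2 ^ ((5 : ℕ) * Real.logb 2 n) := by
            rw [← hn.pow_eq_rpow]
            exact mul_le_mul (hdiv 128) h1 (by positivity) (by positivity)
        _ = (2 : ℝ) ^ (n / (128 : ℕ) + (5 : ℕ) * Real.logb 2 n) := by rw [← Real.rpow_add two_pos]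
        _ ≤ 2 ^ ((n / (64 : ℕ) : ℝ) - 1) := by
            refine Real.rpow_le_rpow_of_exponent_le one_le_two ?_
            push_cast
            linarith
        _ ≤ _ := rpow_sub_one_le_two_pow_div n 64 (by norm_num)
    exact_mod_cast h2
  have hkt : j + 2 ≤ 2 ^ (n / 128) := by
    have h1 : (n : ℝ) ≤ 2 ^ (n / 128) := by
      calc (n : ℝ) = 2 ^ Real.logb 2 n := hn.rpow_logb.symm
        _ ≤ 2 ^ ((n / (128 : ℕ) : ℝ) - 1) := by
            refine Real.rpow_le_rpow_of_exponent_le one_le_two ?_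
            push_cast
            linarith
        _ ≤ _ := rpow_sub_one_le_two_pow_div n 128 (by norm_num)
    exact hkn.trans (by exact_mod_cast h1)
  have hML : 2 * M ≤ 2 ^ (n / 64) := by
    refine le_trans ?_ ht
    have h1 : 2 * M ≤ 2 * n * M := Nat.mul_le_mul_right _ (by omega)
    have h2 : 2 * n * M ≤ (n * M + 1) * (2 * n * M) := Nat.le_mul_of_pos_left _ (by omega)
    have h3 := Nat.le_mul_of_pos_left ((n * M + 1) * (2 * n * M)) (Nat.two_pow_pos (n / 128))
    exact h1.trans (h2.trans h3)
  refine (prob_not_isLConnected_le hk128' le_rfl hkn hM5 hML ht hkt).trans ?_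
  have h1 : ∑ d ∈ (Finset.range M).filter
      (fun d : ℕ => ((j + 2 : ℕ) : ℝ) - 1 / 2 < Real.logb 2 d),
        closedBound n (j + 2) (j + 2) d ≤ 1 / n := by
    calc _ ≤ ∑ d ∈ (Finset.range M).filter
          (fun d : ℕ => ((j + 2 : ℕ) : ℝ) - 1 / 2 < Real.logb 2 d), (2 : ℝ) ^ (-(n / 10) : ℝ) := by
          refine Finset.sum_le_sum fun d hd => ?_
          rw [Finset.mem_filter, Finset.mem_range] at hd
          refine closedBound_le_of_lt_logb hn hk (le_trans ?_ hM1) hd.2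
          exact mul_le_mul_of_nonneg_left (by exact_mod_cast hd.1.le) (by positivity)
      _ ≤ n * (2 : ℝ) ^ (-(n / 10) : ℝ) := by
          rw [Finset.sum_const, nsmul_eq_mul]
          refine mul_le_mul_of_nonneg_right ?_ (by positivity)
          exact_mod_cast (Finset.card_filter_le _ _).trans ((Finset.card_range M).trans_le hMn)
      _ = 2 ^ (Real.logb 2 n - n / 10) := by
          rw [sub_eq_add_neg, Real.rpow_add two_pos, hn.rpow_logb]
      _ ≤ 2 ^ (-Real.logb 2 n) := Real.rpow_le_rpow_of_exponent_le one_le_two (by linarith)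
      _ = 1 / n := hn.rpow_neg_logb
  have h2 : ∑ d ∈ Finset.Icc M (2 ^ (n / 64)), closedBound n j (j + 2) d ≤ 2 / n := by
    calc _ ≤ ∑ d ∈ Finset.Icc M (2 ^ (n / 64)), (2 : ℝ) ^ (-d : ℝ) := by
          refine Finset.sum_le_sum fun d hd => ?_
          rw [Finset.mem_Icc] at hd
          rcases le_total (d : ℝ) (n ^ 2) with hdn | hdn
          · refine closedBound_le_of_le_sq hn hkn le_rfl hj ?_ hdn
            have : (M : ℝ) ≤ d := by exact_mod_cast hd.1
            have : 2048 * Real.logb 2 n * M ≤ 2048 * Real.logb 2 n * d :=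
              mul_le_mul_of_nonneg_left this (by positivity)
            have : 0 ≤ Real.logb 2 n * d := by positivity
            linarith
          · refine closedBound_le_of_sq_le hn hkn hj hdn ?_
            have h3 : (d : ℝ) ≤ 2 ^ (n / 64) := by exact_mod_cast hd.2
            refine h3.trans ?_
            exact_mod_cast hdiv 64
      _ ≤ 2 * 2 ^ (-M : ℝ) := sum_Icc_half_pow_le _ _
      _ ≤ 2 * 2 ^ (-Real.logb 2 n) := by
          refine mul_le_mul_of_nonneg_left ?_ two_pos.le
          exact Real.rpow_le_rpow_of_exponent_le one_le_two (by linarith)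
      _ = 2 / n := by rw [hn.rpow_neg_logb]; ring
  have h3 : n * (2 ^ n) ^ n *
      ((1 + missProb ((n - j).choose (j + 2 - j)) M (2 ^ (n / 128))) ^ 2 ^ n - 1) ≤
        1 / (n : ℝ) := by
    have hc : 1 ≤ (n - j).choose (j + 2 - j) := Nat.choose_pos (by omega)
    refine mul_one_add_pow_sub_one_le hn (pow_nonneg (one_sub_nonneg_of_one_le hc M) _)
      (missProb_le_exp hn hc ?_ hM1)
    rw [Nat.add_sub_cancel_left]
    have h4 : (n - j).choose 2 ≤ n ^ 2 :=
      (Nat.choose_le_pow _ _).trans (Nat.pow_le_pow_left (Nat.sub_le _ _) 2)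
    exact_mod_cast h4
  calc _ ≤ 1 / (n : ℝ) + (2 / n + 1 / n) := add_le_add h1 (add_le_add h2 h3)
    _ = 4 / n := by ring

lemma nonempty_kOut {n k : ℕ} (hkn : k ≤ n) : Nonempty (KOut n k) :=
  Fintype.card_pos_iff.1 (by rw [card_kOut]; exact pow_pos (Nat.choose_pos hkn) _)

/-- Let `k = k(n)` be a sequence of integers with
`⌈log₂ n − 2·log₂log₂ n⌉ + 1 ≤ k(n) ≤ n−1` (for all large `n`). Then w.h.p.
`Q^n(k(n))` is `k(n)`-connected. -/
theorem stmt_5 (k : ℕ → ℕ)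
    (hk : ∀ᶠ n : ℕ in atTop,
      ⌈Real.logb 2 n - 2 * Real.logb 2 (Real.logb 2 n)⌉ + 1 ≤ (k n : ℤ) ∧ k n ≤ n - 1) :
    Tendsto (fun n : ℕ =>
        prob (fun ω : KOut n (k n) => IsLConnected (kOutGraph n (k n) ω) (k n)))
      atTop (nhds 1) := by
  have hlim : Tendsto (fun n : ℕ => 1 - 4 / (n : ℝ)) atTop (nhds 1) := by
    simpa using tendsto_const_nhds.sub (tendsto_const_div_atTop_nhds_zero_nat (4 : ℝ))
  refine tendsto_of_tendsto_of_tendsto_of_le_of_le' hlim tendsto_const_nhds ?_ ?_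
  · filter_upwards [hk, eventually_isLarge] with n ⟨hk1, hk2⟩ hn
    have hkn : k n ≤ n := hk2.trans (Nat.sub_le _ _)
    have hk3 : Real.logb 2 n - 2 * Real.logb 2 (Real.logb 2 n) + 1 ≤ k n := by
      have h1 : ((⌈Real.logb 2 n - 2 * Real.logb 2 (Real.logb 2 n)⌉ : ℝ) + 1) ≤ k n := by
        exact_mod_cast hk1
      linarith [Int.le_ceil (Real.logb 2 n - 2 * Real.logb 2 (Real.logb 2 n))]
    have : Nonempty (KOut n (k n)) := nonempty_kOut hkn
    have h1 := prob_add_prob_not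
      (fun ω : KOut n (k n) => IsLConnected (kOutGraph n (k n) ω) (k n))
    have h2 := prob_not_isLConnected_le_div hn hkn hk3
    linarith
  · exact Eventually.of_forall fun n => prob_le_one _
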